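/- Fix 0 < p < 1 and suppose t(n) is a sequence of nonnegative integers with t(n) = o(n). Then asymptotically almost surely χ^t(G(n,p)) = (1 + o(1)) · n/(κ_p(t(n)/ln n) · ln n); that is, for every ε > 0, the probability that (1−ε)·n/(κ_p(t(n)/ln n)·ln n) ≤ χ^{t(n)}(G(n,p)) ≤ (1+ε)·n/(κ_p(t(n)/ln n)·ln n) tends to 1 as n → ∞. -/

import Mathlib

open MeasureTheory Filter
open scoped ENNReal NNReal

/-- The Bernoulli(p) measure on `Bool`. -/
noncomputable def bernoulliBool (p : ℝ) : Measure Bool :=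
  p.toNNReal • Measure.dirac true + (1 - p).toNNReal • Measure.dirac false

instance (p : ℝ) : IsFiniteMeasure (bernoulliBool p) := by
  unfold bernoulliBool; infer_instance

instance (n : ℕ) : MeasurableSpace (SimpleGraph (Fin n)) := ⊤

/-- The Erdős–Rényi random graph `G(n,p)`: the distribution of the simple graph on `Fin n`
obtained by including each possible edge independently with probability `p`. -/
noncomputable def erMeasure (n : ℕ) (p : ℝ) : Measure (SimpleGraph (Fin n)) :=
  Measure.map (fun f : Sym2 (Fin n) → Bool => SimpleGraph.fromEdgeSet {e | f e = true})
    (Measure.pi fun _ : Sym2 (Fin n) => bernoulliBool p)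

/-- A set `S` of vertices is `t`-dependent if the induced subgraph has maximum degree at most `t`,
i.e. every vertex of `S` has at most `t` neighbours inside `S`. -/
def IsTDependent {V : Type*} (G : SimpleGraph V) (t : ℕ) (S : Set V) : Prop :=
  ∀ v ∈ S, {u ∈ S | G.Adj v u}.ncard ≤ t

/-- The `t`-improper chromatic number: the least number of colours in a vertex colouring
in which every colour class is `t`-dependent. -/
noncomputable def improperChromaticNumber {V : Type*} (G : SimpleGraph V) (t : ℕ) : ℕ :=
  sInf {k | ∃ c : V → Fin k, ∀ i : Fin k, IsTDependent G t {v | c v = i}}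

/-- The `t`-dependence number: the maximum size of a `t`-dependent set. -/
noncomputable def tDependenceNumber {V : Type*} (G : SimpleGraph V) (t : ℕ) : ℕ :=
  sSup {m | ∃ S : Set V, S.ncard = m ∧ IsTDependent G t S}

/-- The Fenchel–Legendre transform `Λ*(x) = x ln(x/p) + (1-x) ln((1-x)/(1-p))`
(with the conventions `Λ*(0) = ln(1/(1-p))`, `Λ*(1) = ln(1/p)`, which hold automatically
since `Real.log 0 = 0` in Lean). -/
noncomputable def LambdaStar (p x : ℝ) : ℝ :=
  x * Real.log (x / p) + (1 - x) * Real.log ((1 - x) / (1 - p))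

section BernoulliProduct

set_option linter.unusedSectionVars false

variable {E : Type*} [Fintype E] [DecidableEq E]

/-- The weight of `f` under the product of the Bernoulli measures with parameters `p e`. -/
noncomputable def bernWeight (p : E → ℝ) (f : E → Bool) : ℝ :=
  ∏ e, if f e = true then p e else 1 - p e

/-- Expectation under the product of the Bernoulli measures with parameters `p e`. -/
noncomputable def bernExp (p : E → ℝ) (F : (E → Bool) → ℝ) : ℝ :=
  ∑ f, bernWeight p f * F f

/-- Probability under the product of the Bernoulli measures with parameters `p e`. -/
noncomputable def bernProb (p : E → ℝ) (A : Set (E → Bool)) : ℝ :=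
  bernExp p (A.indicator fun _ => 1)

lemma bernWeight_nonneg {p : E → ℝ} (hp : ∀ e, 0 ≤ p e ∧ p e ≤ 1) (f : E → Bool) :
    0 ≤ bernWeight p f := by
  refine Finset.prod_nonneg fun e _ => ?_
  split_ifs
  · exact (hp e).1
  · linarith [(hp e).2]

lemma bernExp_mono {p : E → ℝ} (hp : ∀ e, 0 ≤ p e ∧ p e ≤ 1) {F G : (E → Bool) → ℝ}
    (h : ∀ f, F f ≤ G f) : bernExp p F ≤ bernExp p G :=
  Finset.sum_le_sum fun f _ => mul_le_mul_of_nonneg_left (h f) (bernWeight_nonneg hp f)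

lemma bernExp_prod (p : E → ℝ) (g : E → Bool → ℝ) :
    bernExp p (fun f => ∏ e, g e (f e)) =
      ∏ e, (p e * g e true + (1 - p e) * g e false) := by
  have h := Finset.prod_univ_sum (fun _ : E => (Finset.univ : Finset Bool))
    (fun e b => (if b = true then p e else 1 - p e) * g e b)
  simp only [Fintype.sum_bool, if_true, Bool.false_eq_true, if_false,
    Fintype.piFinset_univ] at h
  rw [h]
  simp only [bernExp, bernWeight, Finset.prod_mul_distrib]

lemma bernExp_const (p : E → ℝ) (c : ℝ) : bernExp p (fun _ => c) = c := by
  have h := bernExp_prod p (fun _ _ => 1)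
  simp only [Finset.prod_const_one, mul_one, add_sub_cancel] at h
  have : bernExp p (fun _ => c) = bernExp p (fun _ => 1) * c := by
    simp [bernExp, Finset.sum_mul]
  rw [this, h, one_mul]

lemma bernExp_add (p : E → ℝ) (F G : (E → Bool) → ℝ) :
    bernExp p (fun f => F f + G f) = bernExp p F + bernExp p G := by
  simp [bernExp, mul_add, Finset.sum_add_distrib]

lemma bernExp_sub (p : E → ℝ) (F G : (E → Bool) → ℝ) :
    bernExp p (fun f => F f - G f) = bernExp p F - bernExp p G := by
  simp [bernExp, mul_sub, Finset.sum_sub_distrib]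

lemma bernExp_const_mul (p : E → ℝ) (c : ℝ) (F : (E → Bool) → ℝ) :
    bernExp p (fun f => c * F f) = c * bernExp p F := by
  simp only [bernExp, Finset.mul_sum]
  exact Finset.sum_congr rfl fun f _ => by ring

lemma bernExp_sum {ι : Type*} (p : E → ℝ) (s : Finset ι) (F : ι → (E → Bool) → ℝ) :
    bernExp p (fun f => ∑ i ∈ s, F i f) = ∑ i ∈ s, bernExp p (F i) := by
  simp only [bernExp, Finset.mul_sum]
  rw [Finset.sum_comm]

lemma exists_bernExp_le {p : E → ℝ} (hp : ∀ e, 0 ≤ p e ∧ p e ≤ 1) (F : (E → Bool) → ℝ) :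
    ∃ f, bernExp p F ≤ F f := by
  obtain ⟨f, -, hf⟩ := Finset.exists_max_image (Finset.univ : Finset (E → Bool)) F
    Finset.univ_nonempty
  refine ⟨f, ?_⟩
  calc bernExp p F ≤ bernExp p (fun _ => F f) := bernExp_mono hp fun g => hf g (Finset.mem_univ g)
    _ = F f := bernExp_const p _

lemma bernProb_mono {p : E → ℝ} (hp : ∀ e, 0 ≤ p e ∧ p e ≤ 1) {A B : Set (E → Bool)}
    (h : A ⊆ B) : bernProb p A ≤ bernProb p B :=
  bernExp_mono hp fun f => Set.indicator_le_indicator_of_subset h (fun _ => zero_le_one) f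

lemma bernProb_nonneg {p : E → ℝ} (hp : ∀ e, 0 ≤ p e ∧ p e ≤ 1) (A : Set (E → Bool)) :
    0 ≤ bernProb p A :=
  Finset.sum_nonneg fun f _ => mul_nonneg (bernWeight_nonneg hp f)
    (Set.indicator_nonneg (fun _ _ => zero_le_one) f)

lemma bernProb_univ (p : E → ℝ) : bernProb p Set.univ = 1 := by
  simp [bernProb, bernExp_const]

lemma bernProb_le_one {p : E → ℝ} (hp : ∀ e, 0 ≤ p e ∧ p e ≤ 1) (A : Set (E → Bool)) :
    bernProb p A ≤ 1 :=
  (bernProb_mono hp (Set.subset_univ A)).trans_eq (bernProb_univ p)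

lemma bernProb_inter_add_diff (p : E → ℝ) (A B : Set (E → Bool)) :
    bernProb p (A ∩ B) + bernProb p (A \ B) = bernProb p A := by
  simp only [bernProb, ← bernExp_add]
  congr 1
  funext f
  by_cases hA : f ∈ A <;> by_cases hB : f ∈ B <;> simp [hA, hB]

lemma bernProb_compl (p : E → ℝ) (A : Set (E → Bool)) :
    bernProb p Aᶜ = 1 - bernProb p A := by
  have h := bernProb_inter_add_diff p Set.univ A
  rw [bernProb_univ, Set.univ_inter, ← Set.compl_eq_univ_sdiff] at h
  linarith

lemma bernProb_biUnion_le {ι : Type*} {p : E → ℝ} (hp : ∀ e, 0 ≤ p e ∧ p e ≤ 1)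
    (s : Finset ι) (A : ι → Set (E → Bool)) :
    bernProb p (⋃ i ∈ s, A i) ≤ ∑ i ∈ s, bernProb p (A i) := by
  simp only [bernProb, ← bernExp_sum]
  refine bernExp_mono hp fun f => ?_
  have hn : ∀ i ∈ s, 0 ≤ (A i).indicator (fun _ => (1 : ℝ)) f :=
    fun i _ => Set.indicator_nonneg (fun _ _ => zero_le_one) f
  by_cases hf : f ∈ ⋃ i ∈ s, A i
  · obtain ⟨i, hi, hfi⟩ := Set.mem_iUnion₂.1 hf
    rw [Set.indicator_of_mem hf]
    refine le_trans ?_ (Finset.single_le_sum hn hi)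
    rw [Set.indicator_of_mem hfi]
  · rw [Set.indicator_of_notMem hf]
    exact Finset.sum_nonneg hn

lemma bernProb_union_le {p : E → ℝ} (hp : ∀ e, 0 ≤ p e ∧ p e ≤ 1) (A B : Set (E → Bool)) :
    bernProb p (A ∪ B) ≤ bernProb p A + bernProb p B := by
  have h := bernProb_biUnion_le hp Finset.univ (fun b : Bool => bif b then A else B)
  simpa [Set.union_eq_iUnion] using h

/-- Markov's inequality in product form. -/
lemma bernProb_mul_le {p : E → ℝ} (hp : ∀ e, 0 ≤ p e ∧ p e ≤ 1) {A : Set (E → Bool)}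
    {F : (E → Bool) → ℝ} {c : ℝ} (hF : ∀ f, 0 ≤ F f) (h : ∀ f ∈ A, c ≤ F f) :
    bernProb p A * c ≤ bernExp p F := by
  rw [mul_comm, bernProb, ← bernExp_const_mul]
  refine bernExp_mono hp fun f => ?_
  by_cases hf : f ∈ A
  · simpa [hf] using h f hf
  · simpa [hf] using hF f

lemma bernExp_mul_of_dependsOn (p : E → ℝ) {F G : (E → Bool) → ℝ} {s : Set E}
    (hF : DependsOn F s) (hG : DependsOn G sᶜ) :
    bernExp p (fun f => F f * G f) = bernExp p F * bernExp p G := by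
  classical
  let mix : (E → Bool) × (E → Bool) → (E → Bool) := fun x e => if e ∈ s then x.1 e else x.2 e
  have hinv : Function.Involutive
      (fun x : (E → Bool) × (E → Bool) => (mix x, mix x.swap)) := by
    intro x
    ext e <;> by_cases he : e ∈ s <;> simp [mix, he]
  have hw : ∀ x : (E → Bool) × (E → Bool),
      bernWeight p (mix x) * bernWeight p (mix x.swap) = bernWeight p x.1 * bernWeight p x.2 := by
    intro x
    simp only [bernWeight, ← Finset.prod_mul_distrib]
    refine Finset.prod_congr rfl fun e _ => ?_
    by_cases he : e ∈ s <;> simp [mix, he, mul_comm]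
  have h1 : bernExp p F * bernExp p G =
      ∑ x : (E → Bool) × (E → Bool), bernWeight p x.1 * bernWeight p x.2 * (F x.1 * G x.2) := by
    simp only [bernExp, Finset.sum_mul_sum, Fintype.sum_prod_type]
    exact Finset.sum_congr rfl fun f _ => Finset.sum_congr rfl fun g _ => by ring
  have h2 : bernExp p (fun f => F f * G f) =
      ∑ x : (E → Bool) × (E → Bool), bernWeight p x.1 * bernWeight p x.2 * (F x.1 * G x.1) := by
    have hone := bernExp_const p 1
    simp only [bernExp, mul_one] at hone
    simp only [bernExp, Fintype.sum_prod_type]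
    refine Finset.sum_congr rfl fun f _ => ?_
    rw [← Finset.sum_mul, ← Finset.mul_sum, hone, mul_one]
  rw [h1, h2, ← Equiv.sum_comp hinv.toPerm]
  refine Finset.sum_congr rfl fun x _ => ?_
  simp only [Function.Involutive.coe_toPerm, hw]
  congr 2
  · exact hF fun e he => by simp [mix, he]
  · exact hG fun e he => by simp [mix, show e ∉ s from he]

lemma DependsOn.indicator_one {A : Set (E → Bool)} {s : Set E}
    (hA : DependsOn (· ∈ A) s) : DependsOn (A.indicator fun _ => (1 : ℝ)) s := by
  intro f g hfg
  have : (f ∈ A) = (g ∈ A) := hA hfg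
  by_cases hf : f ∈ A
  · rw [Set.indicator_of_mem hf, Set.indicator_of_mem (this ▸ hf)]
  · rw [Set.indicator_of_notMem hf, Set.indicator_of_notMem (this ▸ hf)]

lemma bernProb_inter_of_dependsOn (p : E → ℝ) {A B : Set (E → Bool)} {s : Set E}
    (hA : DependsOn (· ∈ A) s) (hB : DependsOn (· ∈ B) sᶜ) :
    bernProb p (A ∩ B) = bernProb p A * bernProb p B := by
  simp only [bernProb]
  rw [← bernExp_mul_of_dependsOn p hA.indicator_one hB.indicator_one]
  congr 1
  funext f
  by_cases hA : f ∈ A <;> by_cases hB : f ∈ B <;> simp [hA, hB]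

/-- Harris' inequality for a decreasing and an increasing event. -/
lemma bernProb_inter_le_of_lower_upper {p : E → ℝ} (hp : ∀ e, 0 ≤ p e ∧ p e ≤ 1)
    {A B : Set (E → Bool)} (hA : IsLowerSet A) (hB : IsUpperSet B) :
    bernProb p (A ∩ B) ≤ bernProb p A * bernProb p B := by
  have hind : ∀ {U : Set (E → Bool)}, IsUpperSet U →
      Monotone (U.indicator fun _ => (1 : ℝ)) := by
    intro U hU f g hfg
    by_cases hf : f ∈ U
    · rw [Set.indicator_of_mem hf, Set.indicator_of_mem (hU hfg hf)]
    · rw [Set.indicator_of_notMem hf]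
      exact Set.indicator_nonneg (fun _ _ => zero_le_one) g
  have hn : ∀ U : Set (E → Bool), 0 ≤ U.indicator fun _ => (1 : ℝ) :=
    fun U f => Set.indicator_nonneg (fun _ _ => zero_le_one) f
  have hfkg := fkg (μ := bernWeight p) (f := Aᶜ.indicator fun _ => (1 : ℝ))
    (g := B.indicator fun _ => (1 : ℝ)) (fun f => bernWeight_nonneg hp f) (hn _) (hn _)
    (hind hA.compl) (hind hB) (by
      intro f g
      simp only [bernWeight, ← Finset.prod_mul_distrib]
      refine le_of_eq (Finset.prod_congr rfl fun e _ => ?_)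
      cases hf : f e <;> cases hg : g e <;> simp [hf, hg, mul_comm])
  have hone := bernExp_const p 1
  simp only [bernExp, mul_one] at hone
  rw [hone, one_mul] at hfkg
  have h3 : bernProb p Aᶜ * bernProb p B ≤ bernProb p (B \ A) := by
    refine hfkg.trans_eq ?_
    refine Finset.sum_congr rfl fun f _ => ?_
    by_cases hA : f ∈ A <;> by_cases hB : f ∈ B <;> simp [hA, hB]
  have h4 := bernProb_inter_add_diff p B A
  rw [bernProb_compl] at h3
  rw [Set.inter_comm]
  linarith

end BernoulliProduct

section BernoulliInequalities

set_option linter.unusedSectionVars false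

variable {E : Type*} [Fintype E] [DecidableEq E]

lemma bernExp_prod_finset (p : E → ℝ) (s : Finset E) (g : E → Bool → ℝ) :
    bernExp p (fun f => ∏ e ∈ s, g e (f e)) =
      ∏ e ∈ s, (p e * g e true + (1 - p e) * g e false) := by
  have h := bernExp_prod p (fun e b => if e ∈ s then g e b else 1)
  have h1 : ∀ e, (p e * (if e ∈ s then g e true else 1) +
      (1 - p e) * (if e ∈ s then g e false else 1)) =
      if e ∈ s then (p e * g e true + (1 - p e) * g e false) else 1 := by
    intro e
    split_ifs <;> ring
  simp only [h1, Finset.prod_ite_mem, Finset.univ_inter] at h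
  exact h

lemma IsLowerSet.bernProb_inter_biInter_compl_ge {ι : Type*} [DecidableEq ι] {p : E → ℝ}
    (hp : ∀ e, 0 ≤ p e ∧ p e ≤ 1) {A : ι → Set (E → Bool)} {s : ι → Set E}
    (hlow : ∀ i, IsLowerSet (A i)) (hdep : ∀ i, DependsOn (· ∈ A i) (s i))
    {b : ι → ι → ℝ} (hb0 : ∀ i j, 0 ≤ b i j)
    (hb : ∀ i j, i ≠ j → ¬ Disjoint (s i) (s j) → bernProb p (A i ∩ A j) ≤ b i j)
    {W : Finset ι} {i : ι} (hi : i ∉ W) :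
    bernProb p (⋂ j ∈ W, (A j)ᶜ) * (bernProb p (A i) - ∑ j ∈ W, b i j) ≤
      bernProb p ((⋂ j ∈ W, (A j)ᶜ) ∩ A i) := by
  classical
  rcases le_or_gt (bernProb p (A i) - ∑ j ∈ W, b i j) 0 with h0 | h0
  · exact (mul_nonpos_of_nonneg_of_nonpos (bernProb_nonneg hp _) h0).trans (bernProb_nonneg hp _)
  set N := ⋂ j ∈ W, (A j)ᶜ with hN
  set W₁ := W.filter fun j => Disjoint (s i) (s j)
  set W₂ := W.filter fun j => ¬ Disjoint (s i) (s j)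
  set I := ⋂ j ∈ W₁, (A j)ᶜ with hI
  have hNI : N ⊆ I := by
    intro f hf
    simp only [hN, hI, Set.mem_iInter] at hf ⊢
    exact fun j hj => hf j (Finset.mem_filter.1 hj).1
  have hIup : IsUpperSet I :=
    isUpperSet_iInter₂ fun j _ => (hlow j).compl
  have hIdep : DependsOn (· ∈ I) (s i)ᶜ := by
    intro f g hfg
    simp only [hI, Set.mem_iInter, Set.mem_compl_iff, eq_iff_iff]
    refine forall₂_congr fun j hj => not_congr ?_
    have hd := (Finset.mem_filter.1 hj).2
    exact iff_of_eq (hdep j fun e he => hfg e fun he' => Set.disjoint_left.1 hd he' he)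
  have h1 : bernProb p (A i ∩ I) = bernProb p (A i) * bernProb p I :=
    bernProb_inter_of_dependsOn p (hdep i) hIdep
  have h2 : A i ∩ I ⊆ (N ∩ A i) ∪ ⋃ j ∈ W₂, (A i ∩ A j) ∩ I := by
    intro f hf
    by_cases hfN : f ∈ N
    · exact Or.inl ⟨hfN, hf.1⟩
    · right
      simp only [hN, Set.mem_iInter, Set.mem_compl_iff, not_forall, not_not] at hfN
      obtain ⟨j, hj, hfj⟩ := hfN
      refine Set.mem_iUnion₂.2 ⟨j, ?_, ⟨hf.1, hfj⟩, hf.2⟩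
      refine Finset.mem_filter.2 ⟨hj, fun hd => ?_⟩
      exact (Set.mem_iInter₂.1 hf.2 j (Finset.mem_filter.2 ⟨hj, hd⟩)) hfj
  have h3 : ∀ j ∈ W₂, bernProb p ((A i ∩ A j) ∩ I) ≤ b i j * bernProb p I := by
    intro j hj
    refine (bernProb_inter_le_of_lower_upper hp ((hlow i).inter (hlow j)) hIup).trans ?_
    refine mul_le_mul_of_nonneg_right (hb i j ?_ (Finset.mem_filter.1 hj).2)
      (bernProb_nonneg hp _)
    rintro rfl
    exact hi (Finset.mem_filter.1 hj).1
  have h4 : bernProb p (A i ∩ I) ≤ bernProb p (N ∩ A i) + ∑ j ∈ W₂, b i j * bernProb p I :=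
    calc bernProb p (A i ∩ I) ≤ _ := bernProb_mono hp h2
      _ ≤ _ := bernProb_union_le hp _ _
      _ ≤ _ := by
        gcongr
        exact (bernProb_biUnion_le hp _ _).trans (Finset.sum_le_sum h3)
  have h5 : ∑ j ∈ W₂, b i j ≤ ∑ j ∈ W, b i j :=
    Finset.sum_le_sum_of_subset_of_nonneg (Finset.filter_subset _ _) fun j _ _ => hb0 i j
  rw [h1, ← Finset.sum_mul] at h4
  have h6 : bernProb p N ≤ bernProb p I := bernProb_mono hp hNI
  have h7 := bernProb_nonneg hp I
  nlinarith [mul_le_mul_of_nonneg_right h6 h0.le, mul_le_mul_of_nonneg_right h5 h7]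

/-- Janson's inequality (in the form due to Riordan and Warnke) for decreasing events. -/
lemma bernProb_biInter_compl_le {ι : Type*} [DecidableEq ι] {p : E → ℝ}
    (hp : ∀ e, 0 ≤ p e ∧ p e ≤ 1) {A : ι → Set (E → Bool)} {s : ι → Set E}
    (hlow : ∀ i, IsLowerSet (A i)) (hdep : ∀ i, DependsOn (· ∈ A i) (s i))
    {b : ι → ι → ℝ} (hb0 : ∀ i j, 0 ≤ b i j)
    (hb : ∀ i j, i ≠ j → ¬ Disjoint (s i) (s j) → bernProb p (A i ∩ A j) ≤ b i j)
    (W : Finset ι) :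
    bernProb p (⋂ i ∈ W, (A i)ᶜ) ≤
      Real.exp (-(∑ i ∈ W, bernProb p (A i) - ∑ i ∈ W, ∑ j ∈ W.erase i, b i j)) := by
  induction W using Finset.induction_on with
  | empty => simp [bernProb_univ]
  | insert i W hi ih =>
    have h1 := IsLowerSet.bernProb_inter_biInter_compl_ge hp hlow hdep hb0 hb hi
    have h2 := bernProb_inter_add_diff p (⋂ j ∈ W, (A j)ᶜ) (A i)
    have h3 : ⋂ j ∈ insert i W, (A j)ᶜ = (⋂ j ∈ W, (A j)ᶜ) \ A i := by
      rw [Finset.set_biInter_insert, Set.inter_comm, Set.sdiff_eq]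
    have h4 : ∑ j ∈ W, b i j + ∑ k ∈ W, ∑ j ∈ W.erase k, b k j ≤
        ∑ k ∈ insert i W, ∑ j ∈ (insert i W).erase k, b k j := by
      rw [Finset.sum_insert hi, Finset.erase_insert hi]
      gcongr with k hk
      · exact fun _ _ _ => hb0 _ _
      · exact Finset.subset_insert i W
    rw [h3]
    set N := bernProb p (⋂ j ∈ W, (A j)ᶜ)
    have hN : 0 ≤ N := bernProb_nonneg hp _
    calc bernProb p ((⋂ j ∈ W, (A j)ᶜ) \ A i)
        ≤ N * (1 - (bernProb p (A i) - ∑ j ∈ W, b i j)) := by linarith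
      _ ≤ N * Real.exp (-(bernProb p (A i) - ∑ j ∈ W, b i j)) := by
        gcongr
        exact Real.one_sub_le_exp_neg _
      _ ≤ Real.exp (-(∑ i ∈ W, bernProb p (A i) - ∑ i ∈ W, ∑ j ∈ W.erase i, b i j)) *
          Real.exp (-(bernProb p (A i) - ∑ j ∈ W, b i j)) := by gcongr
      _ ≤ _ := by
        rw [← Real.exp_add, Real.exp_le_exp, Finset.sum_insert hi]
        linarith

lemma exists_finset_sum_sub_sum_ge {ι : Type*} [DecidableEq ι] (F : Finset ι) (r a : ι → ℝ)
    (hr : ∀ i ∈ F, 0 ≤ r i ∧ r i ≤ 1) (b : ι → ι → ℝ) :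
    ∃ W ⊆ F, ∑ i ∈ F, r i * a i - ∑ i ∈ F, ∑ j ∈ F.erase i, r i * r j * b i j ≤
      ∑ i ∈ W, a i - ∑ i ∈ W, ∑ j ∈ W.erase i, b i j := by
  have hr' : ∀ i : F, 0 ≤ r i ∧ r i ≤ 1 := fun i => hr i i.2
  let x : Bool → ℝ := fun c => if c then 1 else 0
  have hone : ∀ i : F, bernExp (fun i : F => r i) (fun f => x (f i)) = r i := by
    intro i
    have := bernExp_prod_finset (fun i : F => r i) {i} (fun _ c => x c)
    simpa [x] using this
  have htwo : ∀ i j : F, i ≠ j →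
      bernExp (fun i : F => r i) (fun f => x (f i) * x (f j)) = r i * r j := by
    intro i j hij
    have := bernExp_prod_finset (fun i : F => r i) {i, j} (fun _ c => x c)
    simpa [x, Finset.prod_pair hij] using this
  obtain ⟨f, hf⟩ := exists_bernExp_le hr' (fun f => ∑ i : F, a i * x (f i) -
    ∑ i : F, ∑ j ∈ Finset.univ.erase i, b i j * (x (f i) * x (f j)))
  have hsub : ∀ G : ι → ι → ℝ, ∑ i ∈ F, ∑ j ∈ F.erase i, G i j =
      ∑ i : F, ∑ j ∈ Finset.univ.erase i, G i j := by
    intro G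
    have h1 : ∀ i, ∑ j ∈ F.erase i, G i j = ∑ j ∈ F, if j = i then 0 else G i j := by
      intro i
      rw [← Finset.filter_ne', Finset.sum_filter]
      exact Finset.sum_congr rfl fun j _ => by split_ifs <;> simp_all
    have h2 : ∀ i : F, ∑ j ∈ Finset.univ.erase i, G i j =
        ∑ j : F, if (j : ι) = i then 0 else G i j := by
      intro i
      rw [← Finset.filter_ne', Finset.sum_filter]
      exact Finset.sum_congr rfl fun j _ => by
        by_cases h : j = i <;> simp [h]
    simp only [h1, h2]
    rw [← Finset.sum_coe_sort F]
    exact Finset.sum_congr rfl fun i _ => (Finset.sum_coe_sort F _).symm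
  have hL : bernExp (fun i : F => r i) (fun f => ∑ i : F, a i * x (f i) -
      ∑ i : F, ∑ j ∈ Finset.univ.erase i, b i j * (x (f i) * x (f j))) =
      ∑ i ∈ F, r i * a i - ∑ i ∈ F, ∑ j ∈ F.erase i, r i * r j * b i j := by
    rw [bernExp_sub, bernExp_sum, hsub]
    simp only [bernExp_sum, bernExp_const_mul, hone]
    rw [← Finset.sum_coe_sort F]
    congr 1
    · exact Finset.sum_congr rfl fun i _ => mul_comm _ _
    · refine Finset.sum_congr rfl fun i _ => Finset.sum_congr rfl fun j hj => ?_
      rw [htwo i j (Finset.ne_of_mem_erase hj).symm]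
      ring
  rw [hL] at hf
  let y : ι → ℝ := fun i => if h : i ∈ F then x (f ⟨i, h⟩) else 0
  have hy : ∀ i : F, x (f i) = y i := fun i => by simp [y]
  refine ⟨F.filter fun i => y i = 1, Finset.filter_subset _ _, hf.trans_eq ?_⟩
  have hy0 : ∀ i, y i ≠ 1 → y i = 0 := by
    intro i hi
    by_cases h : i ∈ F
    · cases hfi : f ⟨i, h⟩ <;> simp_all [y, x]
    · simp [y, h]
  simp only [hy]
  rw [← hsub (fun i j => b i j * (y i * y j)), Finset.sum_coe_sort F (fun i => a i * y i)]
  congr 1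
  · rw [Finset.sum_filter]
    refine Finset.sum_congr rfl fun i _ => ?_
    split_ifs with h
    · rw [h, mul_one]
    · rw [hy0 i h, mul_zero]
  · rw [Finset.sum_filter]
    refine Finset.sum_congr rfl fun i _ => ?_
    by_cases hi : y i = 1
    · rw [if_pos hi, ← Finset.filter_ne', ← Finset.filter_ne', Finset.filter_comm,
        Finset.sum_filter (fun j => y j = 1)]
      refine Finset.sum_congr rfl fun j _ => ?_
      split_ifs with h
      · rw [hi, h, mul_one, mul_one]
      · rw [hy0 j h, mul_zero, mul_zero]
    · rw [if_neg hi, hy0 i hi]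
      simp

/-- A lower-tail form of Janson's inequality for families of decreasing events with bounded
average correlation. -/
lemma bernProb_biInter_compl_le_exp_neg {ι : Type*} [DecidableEq ι] {p : E → ℝ}
    (hp : ∀ e, 0 ≤ p e ∧ p e ≤ 1) {A : ι → Set (E → Bool)} {s : ι → Set E}
    (hlow : ∀ i, IsLowerSet (A i)) (hdep : ∀ i, DependsOn (· ∈ A i) (s i))
    {F : Finset ι} {R : ι → ι → ℝ} (hR0 : ∀ i j, 0 ≤ R i j)
    (hR : ∀ i ∈ F, ∀ j ∈ F, i ≠ j → ¬ Disjoint (s i) (s j) →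
      bernProb p (A i ∩ A j) ≤ R i j * (bernProb p (A i) * bernProb p (A j)))
    {D ρ : ℝ} (hD : 0 < D) (hρ : 0 < ρ) (hA : ∀ i ∈ F, ρ ≤ bernProb p (A i))
    (hsum : ∑ i ∈ F, ∑ j ∈ F.erase i, R i j ≤ D * (F.card : ℝ) ^ 2)
    (hM : 1 ≤ 2 * F.card * D * ρ) :
    bernProb p (⋂ i ∈ F, (A i)ᶜ) ≤ Real.exp (-(1 / (4 * D))) := by
  have hM0 : 0 < (F.card : ℝ) := by
    by_contra h
    have : (F.card : ℝ) = 0 := le_antisymm (not_lt.1 h) (Nat.cast_nonneg _)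
    rw [this] at hM
    norm_num at hM
  set M : ℝ := (F.card : ℝ)
  set σ : ℝ := 1 / (2 * M * D) with hσ
  have hσ0 : 0 < σ := by positivity
  have hσρ : σ ≤ ρ := by
    rw [hσ, div_le_iff₀ (by positivity)]
    linarith
  have hP : ∀ i ∈ F, 0 < bernProb p (A i) := fun i hi => hρ.trans_le (hA i hi)
  let b : ι → ι → ℝ := fun i j =>
    if i ∈ F ∧ j ∈ F then R i j * (bernProb p (A i) * bernProb p (A j)) else 1
  obtain ⟨W, hWF, hW⟩ := exists_finset_sum_sub_sum_ge F (fun i => σ / bernProb p (A i))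
    (fun i => bernProb p (A i))
    (fun i hi => ⟨div_nonneg hσ0.le (hP i hi).le,
      (div_le_one (hP i hi)).2 (hσρ.trans (hA i hi))⟩) b
  have hj := bernProb_biInter_compl_le hp hlow hdep (b := b)
    (fun i j => by
      simp only [b]
      split_ifs
      · exact mul_nonneg (hR0 i j) (mul_nonneg (bernProb_nonneg hp _) (bernProb_nonneg hp _))
      · exact zero_le_one)
    (fun i j hij hd => by
      simp only [b]
      split_ifs with h
      · exact hR i h.1 j h.2 hij hd
      · exact bernProb_le_one hp _) W
  have hsub : ⋂ i ∈ F, (A i)ᶜ ⊆ ⋂ i ∈ W, (A i)ᶜ :=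
    Set.biInter_subset_biInter_left hWF
  refine (bernProb_mono hp hsub).trans (hj.trans (Real.exp_le_exp.2 (neg_le_neg ?_)))
  refine le_trans ?_ hW
  have h1 : ∑ i ∈ F, σ / bernProb p (A i) * bernProb p (A i) = M * σ := by
    rw [Finset.sum_congr rfl fun i hi => div_mul_cancel₀ σ (hP i hi).ne']
    simp [M]
  have h2 : ∑ i ∈ F, ∑ j ∈ F.erase i,
      σ / bernProb p (A i) * (σ / bernProb p (A j)) * b i j =
      σ ^ 2 * ∑ i ∈ F, ∑ j ∈ F.erase i, R i j := by
    simp only [Finset.mul_sum]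
    refine Finset.sum_congr rfl fun i hi => Finset.sum_congr rfl fun j hj => ?_
    have hj' := Finset.mem_of_mem_erase hj
    have := (hP i hi).ne'
    have := (hP j hj').ne'
    simp only [b, if_pos (And.intro hi hj')]
    field_simp
  rw [h1, h2]
  have h3 : σ ^ 2 * ∑ i ∈ F, ∑ j ∈ F.erase i, R i j ≤ σ ^ 2 * (D * M ^ 2) := by gcongr
  have h4 : M * σ - σ ^ 2 * (D * M ^ 2) = 1 / (4 * D) := by
    rw [hσ]
    field_simp
    norm_num
  linarith

lemma bernExp_prod_ite (p : E → ℝ) (s : Finset E) {r : ℝ} (hr : ∀ e ∈ s, p e = r) (c : ℝ) :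
    bernExp p (fun f => c ^ (s.filter fun e => f e = true).card) = (1 + r * (c - 1)) ^ s.card := by
  have h := bernExp_prod_finset p s (fun _ x => if x = true then c else 1)
  simp only [Finset.prod_ite, Finset.prod_const, one_pow, mul_one] at h
  rw [h, ← Finset.prod_const]
  refine Finset.prod_congr rfl fun e he => ?_
  rw [hr e he]
  simp
  ring

lemma bernProb_card_ge_le {p : E → ℝ} (hp : ∀ e, 0 ≤ p e ∧ p e ≤ 1) (s : Finset E) {r δ : ℝ}
    (hr : ∀ e ∈ s, p e = r) (hr0 : 0 ≤ r) (hr1 : r ≤ 1) (hδ0 : 0 ≤ δ) (hδ : δ ≤ 1) :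
    bernProb p {f | (r + δ) * s.card ≤ ((s.filter fun e => f e = true).card : ℝ)} ≤
      Real.exp (-(δ ^ 2 / 4 * s.card)) := by
  have h1 := bernProb_mul_le hp
    (A := {f | (r + δ) * s.card ≤ ((s.filter fun e => f e = true).card : ℝ)})
    (F := fun f => Real.exp (δ / 2) ^ (s.filter fun e => f e = true).card)
    (c := Real.exp (δ / 2 * ((r + δ) * s.card))) (fun f => by positivity)
    (fun f hf => by
      rw [← Real.exp_nat_mul, Real.exp_le_exp, mul_comm]
      exact mul_le_mul_of_nonneg_right hf (by linarith))
  rw [bernExp_prod_ite p s hr] at h1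
  have h2 := (abs_le.1 (Real.abs_exp_sub_one_sub_id_le (x := δ / 2)
    (abs_le.2 ⟨by linarith, by linarith⟩))).2
  have h3 : 1 + r * (Real.exp (δ / 2) - 1) ≤ Real.exp (r * (δ / 2) + (δ / 2) ^ 2) := by
    refine le_trans ?_ (Real.add_one_le_exp _)
    nlinarith [sq_nonneg (δ / 2)]
  have h4 : (1 + r * (Real.exp (δ / 2) - 1)) ^ s.card ≤
      Real.exp (s.card * (r * (δ / 2) + (δ / 2) ^ 2)) := by
    rw [Real.exp_nat_mul]
    refine pow_le_pow_left₀ ?_ h3 _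
    have := Real.one_le_exp (x := δ / 2) (by linarith)
    nlinarith
  have h5 := h1.trans h4
  rw [← le_div_iff₀ (Real.exp_pos _), ← Real.exp_sub] at h5
  refine h5.trans (Real.exp_le_exp.2 (le_of_eq ?_))
  ring

lemma bernProb_card_le_le {p : E → ℝ} (hp : ∀ e, 0 ≤ p e ∧ p e ≤ 1) (s : Finset E) {r δ : ℝ}
    (hr : ∀ e ∈ s, p e = r) (hr0 : 0 ≤ r) (hr1 : r ≤ 1) (hδ0 : 0 ≤ δ) (hδ : δ ≤ 1) :
    bernProb p {f | ((s.filter fun e => f e = true).card : ℝ) ≤ (r - δ) * s.card} ≤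
      Real.exp (-(δ ^ 2 / 4 * s.card)) := by
  have h1 := bernProb_mul_le hp
    (A := {f | ((s.filter fun e => f e = true).card : ℝ) ≤ (r - δ) * s.card})
    (F := fun f => Real.exp (-(δ / 2)) ^ (s.filter fun e => f e = true).card)
    (c := Real.exp (-(δ / 2) * ((r - δ) * s.card))) (fun f => by positivity)
    (fun f hf => by
      rw [← Real.exp_nat_mul, Real.exp_le_exp, mul_comm (Nat.cast _)]
      exact mul_le_mul_of_nonpos_left hf (by linarith))
  rw [bernExp_prod_ite p s hr] at h1
  have h2 := (abs_le.1 (Real.abs_exp_sub_one_sub_id_le (x := -(δ / 2))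
    (abs_le.2 ⟨by linarith, by linarith⟩))).2
  have h3 : 1 + r * (Real.exp (-(δ / 2)) - 1) ≤ Real.exp (r * (-(δ / 2)) + (δ / 2) ^ 2) := by
    refine le_trans ?_ (Real.add_one_le_exp _)
    nlinarith [sq_nonneg (δ / 2)]
  have h4 : (1 + r * (Real.exp (-(δ / 2)) - 1)) ^ s.card ≤
      Real.exp (s.card * (r * (-(δ / 2)) + (δ / 2) ^ 2)) := by
    rw [Real.exp_nat_mul]
    refine pow_le_pow_left₀ ?_ h3 _
    have := Real.exp_pos (-(δ / 2))
    nlinarith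
  have h5 := h1.trans h4
  rw [← le_div_iff₀ (Real.exp_pos _), ← Real.exp_sub] at h5
  refine h5.trans (Real.exp_le_exp.2 (le_of_eq ?_))
  ring

end BernoulliInequalities

section LambdaStarAnalysis

variable {p : ℝ}

lemma LambdaStar_eq (hp0 : 0 < p) (hp1 : p < 1) (x : ℝ) :
    LambdaStar p x = x * Real.log x + (1 - x) * Real.log (1 - x) -
      x * Real.log p - (1 - x) * Real.log (1 - p) := by
  have h1 : x * Real.log (x / p) = x * Real.log x - x * Real.log p := by
    rcases eq_or_ne x 0 with rfl | hx
    · simp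
    · rw [Real.log_div hx hp0.ne']; ring
  have h2 : (1 - x) * Real.log ((1 - x) / (1 - p)) =
      (1 - x) * Real.log (1 - x) - (1 - x) * Real.log (1 - p) := by
    rcases eq_or_ne (1 - x) 0 with hx | hx
    · simp [hx]
    · rw [Real.log_div hx (by linarith)]; ring
  rw [LambdaStar, h1, h2]
  ring

lemma continuous_LambdaStar (hp0 : 0 < p) (hp1 : p < 1) : Continuous (LambdaStar p) := by
  have h : LambdaStar p = fun x => x * Real.log x + (1 - x) * Real.log (1 - x) -
      x * Real.log p - (1 - x) * Real.log (1 - p) := funext (LambdaStar_eq hp0 hp1)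
  rw [h]
  have h1 := Real.continuous_mul_log
  have h2 : Continuous fun x : ℝ => (1 - x) * Real.log (1 - x) :=
    h1.comp (continuous_const.sub continuous_id)
  fun_prop

lemma LambdaStar_zero (p : ℝ) : LambdaStar p 0 = -Real.log (1 - p) := by
  simp [LambdaStar]

lemma LambdaStar_self (hp0 : 0 < p) (hp1 : p < 1) : LambdaStar p p = 0 := by
  rw [LambdaStar, div_self hp0.ne', div_self (by linarith)]
  simp

lemma hasDerivAt_LambdaStar (hp0 : 0 < p) (hp1 : p < 1) {x : ℝ} (hx0 : 0 < x) (hx1 : x < 1) :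
    HasDerivAt (LambdaStar p)
      (Real.log x - Real.log (1 - x) - Real.log p + Real.log (1 - p)) x := by
  have h : LambdaStar p = fun x => x * Real.log x + (1 - x) * Real.log (1 - x) -
      x * Real.log p - (1 - x) * Real.log (1 - p) := funext (LambdaStar_eq hp0 hp1)
  rw [h]
  have h1 := Real.hasDerivAt_mul_log hx0.ne'
  have h3 : HasDerivAt (fun x : ℝ => 1 - x) (-1) x := by
    simpa using (hasDerivAt_id x).const_sub 1
  have h2 : HasDerivAt (fun x : ℝ => (1 - x) * Real.log (1 - x)) _ x :=
    (Real.hasDerivAt_mul_log (by linarith : (1 - x) ≠ 0)).comp x h3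
  have h4 := ((h1.add h2).sub ((hasDerivAt_id x).mul_const (Real.log p))).sub
    (h3.mul_const (Real.log (1 - p)))
  refine HasDerivAt.congr_deriv h4 ?_
  ring

lemma strictAntiOn_LambdaStar (hp0 : 0 < p) (hp1 : p < 1) :
    StrictAntiOn (LambdaStar p) (Set.Icc 0 p) := by
  refine strictAntiOn_of_deriv_neg (convex_Icc 0 p)
    (continuous_LambdaStar hp0 hp1).continuousOn fun x hx => ?_
  rw [interior_Icc] at hx
  rw [(hasDerivAt_LambdaStar hp0 hp1 hx.1 (hx.2.trans hp1)).deriv]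
  have h1 := Real.log_lt_log hx.1 hx.2
  have h2 := Real.log_lt_log (by linarith : 0 < 1 - p) (by linarith [hx.2] : 1 - p < 1 - x)
  linarith

lemma LambdaStar_anti (hp0 : 0 < p) (hp1 : p < 1) {x y : ℝ} (hx : 0 ≤ x) (hxy : x ≤ y)
    (hy : y ≤ p) : LambdaStar p y ≤ LambdaStar p x :=
  (strictAntiOn_LambdaStar hp0 hp1).antitoneOn ⟨hx, hxy.trans hy⟩ ⟨hx.trans hxy, hy⟩ hxy

lemma LambdaStar_pos (hp0 : 0 < p) (hp1 : p < 1) {x : ℝ} (hx : 0 ≤ x) (hxp : x < p) :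
    0 < LambdaStar p x := by
  rw [← LambdaStar_self hp0 hp1]
  exact strictAntiOn_LambdaStar hp0 hp1 ⟨hx, hxp.le⟩ ⟨hp0.le, le_rfl⟩ hxp

section Kappa

variable {τ κ : ℝ}

lemma kappa_pos (hp0 : 0 < p) (hτ : 0 ≤ τ) (hκ : τ / p < κ) : 0 < κ :=
  (div_nonneg hτ hp0.le).trans_lt hκ

lemma div_kappa_lt (hp0 : 0 < p) (hτ : 0 ≤ τ) (hκ : τ / p < κ) : τ / κ < p := by
  rw [div_lt_iff₀ (kappa_pos hp0 hτ hκ)]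
  rw [div_lt_iff₀ hp0] at hκ
  linarith

lemma le_kappa (hp0 : 0 < p) (hp1 : p < 1) (hτ : 0 ≤ τ) (hκ : τ / p < κ)
    (h : κ / 2 * LambdaStar p (τ / κ) = 1) : 2 / -Real.log (1 - p) ≤ κ := by
  have hκ0 := kappa_pos hp0 hτ hκ
  have h1 := LambdaStar_anti hp0 hp1 le_rfl (div_nonneg hτ hκ0.le) (div_kappa_lt hp0 hτ hκ).le
  rw [LambdaStar_zero] at h1
  have h2 : 0 < -Real.log (1 - p) := by
    have := Real.log_neg (by linarith : 0 < 1 - p) (by linarith)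
    linarith
  rw [div_le_iff₀ h2]
  nlinarith

lemma kappa_le (hp0 : 0 < p) (hp1 : p < 1) {C : ℝ} (hτ : 0 ≤ τ) (hτC : τ ≤ C) (hκ : τ / p < κ)
    (h : κ / 2 * LambdaStar p (τ / κ) = 1) :
    κ ≤ max (2 * C / p) (2 / LambdaStar p (p / 2)) := by
  have hκ0 := kappa_pos hp0 hτ hκ
  rcases le_total κ (2 * C / p) with h1 | h1
  · exact le_max_of_le_left h1
  · refine le_max_of_le_right ?_
    rw [div_le_iff₀ hp0] at h1
    have h2 : τ / κ ≤ p / 2 := by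
      rw [div_le_iff₀ hκ0]
      linarith
    have h3 := LambdaStar_anti hp0 hp1 (div_nonneg hτ hκ0.le) h2 (by linarith)
    have h4 := LambdaStar_pos hp0 hp1 (by linarith : 0 ≤ p / 2) (by linarith)
    rw [le_div_iff₀ h4]
    nlinarith

lemma le_half_mul_LambdaStar (hp0 : 0 < p) (hp1 : p < 1) (hτ : 0 ≤ τ) (hκ : τ / p < κ)
    (h : κ / 2 * LambdaStar p (τ / κ) = 1) {c κ' : ℝ} (hc : 1 ≤ c) (hκ' : c * κ ≤ κ') :
    c ≤ κ' / 2 * LambdaStar p (τ / κ') := by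
  have hκ0 := kappa_pos hp0 hτ hκ
  have hle : κ ≤ κ' := by nlinarith
  have h1 := LambdaStar_anti hp0 hp1 (div_nonneg hτ (hκ0.trans_le hle).le)
    (div_le_div_of_nonneg_left hτ hκ0 hle) (div_kappa_lt hp0 hτ hκ).le
  have h2 : 0 < LambdaStar p (τ / κ) := by
    by_contra h3
    nlinarith
  nlinarith

lemma half_mul_LambdaStar_min_le (hp0 : 0 < p) (hp1 : p < 1) (hτ : 0 ≤ τ) (hκ : τ / p < κ)
    (h : κ / 2 * LambdaStar p (τ / κ) = 1) {c κ' : ℝ} (hc : c ≤ 1) (hκ'0 : 0 < κ')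
    (hκ' : κ' ≤ c * κ) : κ' / 2 * LambdaStar p (min (τ / κ') p) ≤ c := by
  have hκ0 := kappa_pos hp0 hτ hκ
  have hle : κ' ≤ κ := by nlinarith
  have h1 := LambdaStar_anti hp0 hp1 (div_nonneg hτ hκ0.le)
    (le_min (div_le_div_of_nonneg_left hτ hκ'0 hle) (div_kappa_lt hp0 hτ hκ).le)
    (min_le_right _ _)
  have h2 : 0 < LambdaStar p (τ / κ) := by
    by_contra h3
    nlinarith
  nlinarith

lemma exists_kappa_le_mul_div (hp0 : 0 < p) (hp1 : p < 1) {δ : ℝ} (hδ : 0 < δ) :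
    ∃ C > 0, ∀ τ κ : ℝ, C ≤ τ → τ / p < κ → κ / 2 * LambdaStar p (τ / κ) = 1 →
      κ ≤ (1 + δ) * (τ / p) := by
  have hx : p / (1 + δ) < p := by
    rw [div_lt_iff₀ (by linarith)]
    nlinarith
  have hx0 : 0 ≤ p / (1 + δ) := by positivity
  have hΛ := LambdaStar_pos hp0 hp1 hx0 hx
  refine ⟨2 / LambdaStar p (p / (1 + δ)), by positivity, fun τ κ hτC hκ h => ?_⟩
  rw [div_le_iff₀ hΛ] at hτC
  have hτ : 0 < τ := by
    by_contra h'
    nlinarith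
  by_contra! hlt
  have hκ0 := kappa_pos hp0 hτ.le hκ
  have h1 : τ / κ ≤ p / (1 + δ) := by
    rw [div_le_div_iff₀ hκ0 (by linarith)]
    rw [← mul_div_assoc, div_lt_iff₀ hp0] at hlt
    nlinarith
  have h2 := LambdaStar_anti hp0 hp1 (div_nonneg hτ.le hκ0.le) h1 hx.le
  have h3 : τ < κ := by
    rw [div_lt_iff₀ hp0] at hκ
    nlinarith
  nlinarith

end Kappa

lemma exists_abs_LambdaStar_sub_le (hp0 : 0 < p) (hp1 : p < 1) {η : ℝ} (hη : 0 < η) :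
    ∃ δ > 0, ∀ x ∈ Set.Icc (0 : ℝ) 1, ∀ y ∈ Set.Icc (0 : ℝ) 1, |x - y| ≤ δ →
      LambdaStar p x ≤ LambdaStar p y + η := by
  have h := isCompact_Icc.uniformContinuousOn_of_continuous
    (continuous_LambdaStar hp0 hp1).continuousOn (s := Set.Icc (0 : ℝ) 1)
  obtain ⟨δ, hδ, H⟩ := Metric.uniformContinuousOn_iff.1 h η hη
  refine ⟨δ / 2, by positivity, fun x hx y hy hxy => ?_⟩
  have := H x hx y hy (by rw [Real.dist_eq]; linarith)
  rw [Real.dist_eq] at this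
  linarith [(abs_lt.1 this).2]

end LambdaStarAnalysis

section DependentSets

set_option linter.unusedSectionVars false

variable {V : Type*} [Fintype V] [DecidableEq V]

/-- The number of neighbours of `v` inside `S` in the graph with edge indicator `f`. -/
def degreeIn (f : Sym2 V → Bool) (S : Finset V) (v : V) : ℕ :=
  ((S.erase v).filter fun u => f s(v, u) = true).card

/-- The event that every vertex of `U` has at most `t` neighbours inside `S`. -/
def degreeLeEvent (t : ℕ) (U S : Finset V) : Set (Sym2 V → Bool) :=
  {f | ∀ v ∈ U, degreeIn f S v ≤ t}

/-- The potential edges inside `S`. -/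
def pairsIn (S : Finset V) : Finset (Sym2 V) :=
  S.sym2.filter fun e => ¬ e.IsDiag

lemma mk_mem_pairsIn {S : Finset V} {u v : V} :
    s(u, v) ∈ pairsIn S ↔ u ∈ S ∧ v ∈ S ∧ u ≠ v := by
  simp [pairsIn, and_assoc]

lemma card_pairsIn (S : Finset V) : (pairsIn S).card = S.card.choose 2 := by
  rw [← Sym2.card_image_offDiag]
  congr 1
  ext e
  induction e with
  | _ x y =>
    simp only [mk_mem_pairsIn, Finset.mem_image, Finset.mem_offDiag, Prod.exists]
    constructor
    · rintro ⟨hx, hy, hxy⟩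
      exact ⟨x, y, ⟨hx, hy, hxy⟩, rfl⟩
    · rintro ⟨a, b, ⟨ha, hb, hab⟩, h⟩
      rcases Sym2.eq_iff.1 h with ⟨rfl, rfl⟩ | ⟨rfl, rfl⟩
      · exact ⟨ha, hb, hab⟩
      · exact ⟨hb, ha, hab.symm⟩

lemma degreeIn_mono {f g : Sym2 V → Bool} (h : f ≤ g) (S : Finset V) (v : V) :
    degreeIn f S v ≤ degreeIn g S v := by
  refine Finset.card_le_card fun u hu => ?_
  rw [Finset.mem_filter] at hu ⊢
  refine ⟨hu.1, ?_⟩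
  have := h s(v, u)
  rw [hu.2] at this
  exact eq_top_iff.2 this

lemma isLowerSet_degreeLeEvent (t : ℕ) (U S : Finset V) : IsLowerSet (degreeLeEvent t U S) :=
  fun _ _ hgf hf v hv => (degreeIn_mono hgf S v).trans (hf v hv)

lemma degreeIn_congr {f g : Sym2 V → Bool} {S : Finset V} {v : V}
    (h : ∀ u ∈ S, u ≠ v → f s(v, u) = g s(v, u)) : degreeIn f S v = degreeIn g S v := by
  unfold degreeIn
  congr 1
  refine Finset.filter_congr fun u hu => ?_
  rw [h u (Finset.mem_of_mem_erase hu) (Finset.ne_of_mem_erase hu)]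

lemma dependsOn_degreeLeEvent (t : ℕ) {U S : Finset V} {s : Set (Sym2 V)}
    (h : ∀ v ∈ U, ∀ u ∈ S, u ≠ v → s(v, u) ∈ s) :
    DependsOn (· ∈ degreeLeEvent t U S) s := by
  intro f g hfg
  simp only [degreeLeEvent, Set.mem_ofPred_eq, eq_iff_iff]
  refine forall₂_congr fun v hv => ?_
  rw [degreeIn_congr fun u hu huv => hfg _ (h v hv u hu huv)]

lemma dependsOn_degreeLeEvent_pairsIn (t : ℕ) (S : Finset V) :
    DependsOn (· ∈ degreeLeEvent t S S) (pairsIn S : Set (Sym2 V)) :=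
  dependsOn_degreeLeEvent t fun _ hv _ hu huv => mk_mem_pairsIn.2 ⟨hv, hu, huv.symm⟩

lemma degreeIn_subset {S T : Finset V} (h : S ⊆ T) (f : Sym2 V → Bool) (v : V) :
    degreeIn f S v ≤ degreeIn f T v :=
  Finset.card_le_card (Finset.filter_subset_filter _ (Finset.erase_subset_erase v h))

/-- The ordered pairs whose first entry is in `U` and whose second is another element of `T`. -/
def arcsFrom (U T : Finset V) : Finset (V × V) :=
  (U ×ˢ T).filter fun x => x.1 ≠ x.2

lemma sum_arcsFrom {M : Type*} [AddCommMonoid M] (U T : Finset V) (g : V → V → M) :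
    ∑ x ∈ arcsFrom U T, g x.1 x.2 = ∑ v ∈ U, ∑ u ∈ T.erase v, g v u := by
  rw [arcsFrom, Finset.sum_filter, Finset.sum_product]
  refine Finset.sum_congr rfl fun v _ => ?_
  rw [← Finset.sum_filter]
  refine Finset.sum_congr ?_ fun _ _ => rfl
  ext u
  simp [and_comm, eq_comm]

lemma card_arcsFrom {U T : Finset V} (h : U ⊆ T) :
    (arcsFrom U T).card = U.card * (T.card - 1) := by
  rw [Finset.card_eq_sum_ones, sum_arcsFrom U T fun _ _ => 1]
  simp only [← Finset.card_eq_sum_ones]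
  rw [Finset.sum_congr rfl fun v hv => Finset.card_erase_of_mem (h hv)]
  simp

lemma card_arcsFrom_fiber_le (U T : Finset V) (e : Sym2 V) :
    ((arcsFrom U T).filter fun x => s(x.1, x.2) = e).card ≤ 2 := by
  induction e with
  | _ a b =>
    refine (Finset.card_le_card (t := {(a, b), (b, a)}) fun x hx => ?_).trans Finset.card_le_two
    have := (Finset.mem_filter.1 hx).2
    rw [Sym2.eq_iff] at this
    rw [Finset.mem_insert, Finset.mem_singleton, Prod.ext_iff, Prod.ext_iff]
    exact this

lemma add_mul_pow_le_sqrt_pow {p a : ℝ} (hp0 : 0 ≤ p) (hp1 : p ≤ 1)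
    {w : ℕ} (hw : w ≤ 2) :
    p * a ^ w + (1 - p) ≤ Real.sqrt (p * a ^ 2 + (1 - p)) ^ w := by
  have h0 : 0 ≤ p * a ^ 2 + (1 - p) := by nlinarith [sq_nonneg a]
  interval_cases w
  · simp
  · rw [pow_one, pow_one]
    refine Real.le_sqrt_of_sq_le ?_
    nlinarith [mul_nonneg (mul_nonneg hp0 (sub_nonneg.2 hp1)) (sq_nonneg (a - 1))]
  · rw [Real.sq_sqrt h0]

lemma bernProb_degreeLeEvent_mul_le {p a : ℝ} (hp0 : 0 ≤ p) (hp1 : p ≤ 1) (ha0 : 0 ≤ a)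
    (ha1 : a ≤ 1) (t : ℕ) {U T : Finset V} (h : U ⊆ T) :
    bernProb (fun _ => p) (degreeLeEvent t U T) * a ^ (U.card * t) ≤
      Real.sqrt (p * a ^ 2 + (1 - p)) ^ (U.card * (T.card - 1)) := by
  have hp : ∀ _ : Sym2 V, 0 ≤ p ∧ p ≤ 1 := fun _ => ⟨hp0, hp1⟩
  let w : Sym2 V → ℕ := fun e => ((arcsFrom U T).filter fun x => s(x.1, x.2) = e).card
  have hw : ∀ g : Sym2 V → ℕ, ∑ v ∈ U, ∑ u ∈ T.erase v, g s(v, u) = ∑ e, w e * g e := by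
    intro g
    rw [← sum_arcsFrom U T fun v u => g s(v, u),
      ← Finset.sum_fiberwise (arcsFrom U T) (fun x => s(x.1, x.2))]
    refine Finset.sum_congr rfl fun e _ => ?_
    rw [Finset.sum_congr rfl fun x hx => by rw [(Finset.mem_filter.1 hx).2],
      Finset.sum_const, smul_eq_mul]
  have hdeg : ∀ f : Sym2 V → Bool, ∑ v ∈ U, degreeIn f T v =
      ∑ e, w e * (if f e = true then 1 else 0) := by
    intro f
    rw [← hw]
    refine Finset.sum_congr rfl fun v _ => ?_
    rw [degreeIn, Finset.card_filter]
  have hcard : ∑ e, w e = U.card * (T.card - 1) := by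
    have := hw fun _ => 1
    simp only [mul_one] at this
    rw [← this, ← sum_arcsFrom U T fun _ _ => 1, ← card_arcsFrom h, Finset.card_eq_sum_ones]
  have hm := bernProb_mul_le hp (A := degreeLeEvent t U T) (c := a ^ (U.card * t))
    (F := fun f => ∏ e, a ^ (w e * (if f e = true then 1 else 0)))
    (fun f => Finset.prod_nonneg fun e _ => pow_nonneg ha0 _)
    (fun f hf => by
      rw [Finset.prod_pow_eq_pow_sum, ← hdeg]
      refine pow_le_pow_of_le_one ha0 ha1 ?_
      exact (Finset.sum_le_sum hf).trans_eq (by simp))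
  refine hm.trans ?_
  rw [bernExp_prod (fun _ => p) (fun e b => a ^ (w e * (if b = true then 1 else 0))), ← hcard,
    ← Finset.prod_pow_eq_pow_sum]
  refine Finset.prod_le_prod (fun e _ => ?_) fun e _ => ?_
  · have : 0 ≤ 1 - p := by linarith
    positivity
  · simpa using add_mul_pow_le_sqrt_pow (a := a) hp0 hp1 (card_arcsFrom_fiber_le U T e)

lemma bernProb_degreeLeEvent_le {p : ℝ} (hp0 : 0 < p) (hp1 : p < 1) (t : ℕ) {U T : Finset V}
    (h : U ⊆ T) (hT : 2 ≤ T.card) :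
    bernProb (fun _ => p) (degreeLeEvent t U T) ≤
      Real.exp (-(U.card * (T.card - 1) / 2 *
        LambdaStar p (min (t / (T.card - 1)) p))) := by
  have hp : ∀ _ : Sym2 V, 0 ≤ p ∧ p ≤ 1 := fun _ => ⟨hp0.le, hp1.le⟩
  have hk : (0 : ℝ) < T.card - 1 := by
    have : (2 : ℝ) ≤ T.card := by exact_mod_cast hT
    linarith
  have hkc : ((T.card - 1 : ℕ) : ℝ) = T.card - 1 := by
    rw [Nat.cast_sub (by omega), Nat.cast_one]
  set y : ℝ := t / (T.card - 1) with hy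
  have hy0 : 0 ≤ y := div_nonneg (Nat.cast_nonneg _) hk.le
  have htk : (t : ℝ) = y * (T.card - 1) := by rw [hy, div_mul_cancel₀ _ hk.ne']
  rcases le_or_gt p y with hpy | hyp
  · rw [min_eq_right hpy, LambdaStar_self hp0 hp1]
    simpa using bernProb_le_one hp _
  rw [min_eq_left hyp.le]
  have hy1 : 0 < 1 - y := by linarith
  have hq : 0 < 1 - p := by linarith
  set b : ℝ := y * (1 - p) / (p * (1 - y)) with hb
  have hb0 : 0 ≤ b := by positivity
  have hb1 : b ≤ 1 := by
    rw [hb, div_le_one (by positivity)]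
    nlinarith
  have hM : p * Real.sqrt b ^ 2 + (1 - p) = (1 - p) / (1 - y) := by
    rw [Real.sq_sqrt hb0, hb]
    field_simp
    ring
  have hmain := bernProb_degreeLeEvent_mul_le hp0.le hp1.le (Real.sqrt_nonneg b)
    (Real.sqrt_le_one.2 hb1) t h
  rw [hM] at hmain
  have hMpos : 0 < (1 - p) / (1 - y) := by positivity
  have hR : Real.sqrt ((1 - p) / (1 - y)) ^ (U.card * (T.card - 1)) =
      Real.exp (U.card * (T.card - 1) / 2 * Real.log ((1 - p) / (1 - y))) := by
    rw [← Real.exp_log (Real.sqrt_pos.2 hMpos), ← Real.exp_nat_mul, Real.log_sqrt hMpos.le,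
      Nat.cast_mul, hkc]
    congr 1
    ring
  have hL : Real.sqrt b ^ (U.card * t) = Real.exp (U.card * t / 2 * Real.log b) := by
    rcases Nat.eq_zero_or_pos t with rfl | ht
    · simp
    · have hy0' : 0 < y := div_pos (by exact_mod_cast ht) hk
      have hb0' : 0 < b := by positivity
      rw [← Real.exp_log (Real.sqrt_pos.2 hb0'), ← Real.exp_nat_mul, Real.log_sqrt hb0,
        Nat.cast_mul]
      congr 1
      ring
  have hΛ : LambdaStar p y = y * Real.log b - Real.log ((1 - p) / (1 - y)) := by
    rw [LambdaStar_eq hp0 hp1, Real.log_div hq.ne' hy1.ne']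
    rcases eq_or_ne y 0 with hy00 | hy00
    · simp [hy00]
    · rw [hb, Real.log_div (mul_ne_zero hy00 hq.ne') (mul_ne_zero hp0.ne' hy1.ne'),
        Real.log_mul hy00 hq.ne',
        Real.log_mul hp0.ne' hy1.ne']
      ring
  rw [hR, hL, ← le_div_iff₀ (Real.exp_pos _), ← Real.exp_sub] at hmain
  refine hmain.trans (Real.exp_le_exp.2 (le_of_eq ?_))
  rw [hΛ, htk]
  ring

lemma bernProb_degreeLeEvent_inter_le {p : ℝ} (hp : 0 ≤ p ∧ p ≤ 1) (t : ℕ) (S T : Finset V) :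
    bernProb (fun _ => p) (degreeLeEvent t S S ∩ degreeLeEvent t T T) ≤
      bernProb (fun _ => p) (degreeLeEvent t S S) *
        bernProb (fun _ => p) (degreeLeEvent t (T \ S) T) := by
  rw [← bernProb_inter_of_dependsOn (fun _ => p) (dependsOn_degreeLeEvent_pairsIn t S)
    (dependsOn_degreeLeEvent t fun v hv u _ _ => ?_)]
  · exact bernProb_mono (fun _ => hp) (Set.inter_subset_inter_right _
      fun f hf v hv => hf v (Finset.mem_sdiff.1 hv).1)
  · intro h
    exact (Finset.mem_sdiff.1 hv).2 (mk_mem_pairsIn.1 h).1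

lemma bernProb_forall_false (p : ℝ) (s : Finset (Sym2 V)) :
    bernProb (fun _ => p) {f : Sym2 V → Bool | ∀ e ∈ s, f e = false} = (1 - p) ^ s.card := by
  have h := bernExp_prod_finset (fun _ : Sym2 V => p) s (fun _ b => if b = true then 0 else 1)
  simp only [if_true, Bool.false_eq_true, if_false, mul_zero, zero_add, mul_one,
    Finset.prod_const] at h
  rw [← h, bernProb]
  congr 1
  funext f
  by_cases hf : ∀ e ∈ s, f e = false
  · rw [Set.indicator_of_mem (show f ∈ {f : Sym2 V → Bool | ∀ e ∈ s, f e = false} from hf)]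
    exact (Finset.prod_eq_one fun e he => by simp [hf e he]).symm
  · rw [Set.indicator_of_notMem (show f ∉ {f : Sym2 V → Bool | ∀ e ∈ s, f e = false} from hf)]
    push Not at hf
    obtain ⟨e, he, hfe⟩ := hf
    exact (Finset.prod_eq_zero he (by simpa using hfe)).symm

lemma bernProb_degreeLeEvent_inter_mul_le {p : ℝ} (hp : 0 ≤ p ∧ p ≤ 1) (t : ℕ)
    (S T : Finset V) :
    bernProb (fun _ => p) (degreeLeEvent t S S ∩ degreeLeEvent t T T) *
        (1 - p) ^ (S ∩ T).card.choose 2 ≤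
      bernProb (fun _ => p) (degreeLeEvent t S S) *
        bernProb (fun _ => p) (degreeLeEvent t T T) := by
  have hp' : ∀ _ : Sym2 V, 0 ≤ p ∧ p ≤ 1 := fun _ => hp
  let B : Set (Sym2 V → Bool) :=
    {f | ∀ v ∈ T, degreeIn (fun e => f e && decide (e ∉ pairsIn S)) T v ≤ t}
  let Z : Set (Sym2 V → Bool) := {f | ∀ e ∈ pairsIn (S ∩ T), f e = false}
  have hB : DependsOn (· ∈ B) (pairsIn S : Set (Sym2 V))ᶜ := by
    intro f g hfg
    have : (fun e => f e && decide (e ∉ pairsIn S)) = fun e => g e && decide (e ∉ pairsIn S) := by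
      funext e
      by_cases he : e ∈ pairsIn S
      · simp [he]
      · rw [hfg e he]
    simp only [B, Set.mem_ofPred_eq, this]
  have hZ : DependsOn (· ∈ Z) (pairsIn S : Set (Sym2 V)) := by
    intro f g hfg
    simp only [Z, Set.mem_ofPred_eq, eq_iff_iff]
    refine forall₂_congr fun e he => ?_
    rw [hfg e ?_]
    induction e with
    | _ a b =>
      rw [mk_mem_pairsIn, Finset.mem_inter, Finset.mem_inter] at he
      exact mk_mem_pairsIn.2 ⟨he.1.1, he.2.1.1, he.2.2⟩
  have h1 : degreeLeEvent t T T ⊆ B := fun f hf v hv =>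
    (degreeIn_mono (fun e => by cases f e <;> simp) T v).trans (hf v hv)
  have h2 : bernProb (fun _ => p) Z * bernProb (fun _ => p) B ≤
      bernProb (fun _ => p) (degreeLeEvent t T T) := by
    rw [← bernProb_inter_of_dependsOn (fun _ => p) hZ hB]
    refine bernProb_mono hp' fun f hf v hv => ?_
    refine le_trans (le_of_eq ?_) (hf.2 v hv)
    refine degreeIn_congr fun u hu huv => ?_
    by_cases h : s(v, u) ∈ pairsIn S
    · rw [mk_mem_pairsIn] at h
      have := hf.1 s(v, u) (mk_mem_pairsIn.2
        ⟨Finset.mem_inter.2 ⟨h.1, hv⟩, Finset.mem_inter.2 ⟨h.2.1, hu⟩, h.2.2⟩)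
      simp [this]
    · simp [h]
  rw [bernProb_forall_false, card_pairsIn] at h2
  have h3 : bernProb (fun _ => p) (degreeLeEvent t S S ∩ degreeLeEvent t T T) ≤
      bernProb (fun _ => p) (degreeLeEvent t S S) * bernProb (fun _ => p) B := by
    rw [← bernProb_inter_of_dependsOn (fun _ => p) (dependsOn_degreeLeEvent_pairsIn t S) hB]
    exact bernProb_mono hp' (Set.inter_subset_inter_right _ h1)
  have h4 : 0 ≤ (1 - p) ^ (S ∩ T).card.choose 2 := pow_nonneg (by linarith [hp.2]) _
  have h5 := bernProb_nonneg hp' (degreeLeEvent t S S)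
  calc _ ≤ bernProb (fun _ => p) (degreeLeEvent t S S) * bernProb (fun _ => p) B *
        (1 - p) ^ (S ∩ T).card.choose 2 := by gcongr
    _ = bernProb (fun _ => p) (degreeLeEvent t S S) *
        ((1 - p) ^ (S ∩ T).card.choose 2 * bernProb (fun _ => p) B) := by ring
    _ ≤ _ := by gcongr

lemma bernProb_lt_degreeIn_le {p : Sym2 V → ℝ} (hp : ∀ e, 0 ≤ p e ∧ p e ≤ 1) {r δ : ℝ}
    (hr0 : 0 ≤ r) (hr1 : r ≤ 1) (hδ0 : 0 ≤ δ) (hδ : δ ≤ 1) {S : Finset V} {v : V} (hv : v ∈ S)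
    (hr : ∀ u ∈ S, u ≠ v → p s(v, u) = r) {t : ℕ} (ht : (r + δ) * (S.card - 1) ≤ t) :
    bernProb p {f | t < degreeIn f S v} ≤ Real.exp (-(δ ^ 2 / 4 * (S.card - 1))) := by
  have hinj : Set.InjOn (fun u => s(v, u)) (S.erase v : Set V) :=
    fun a _ b _ h => Sym2.congr_right.1 h
  have hcard : ((S.erase v).image fun u => s(v, u)).card = S.card - 1 := by
    rw [Finset.card_image_of_injOn hinj, Finset.card_erase_of_mem hv]
  have hcast : ((S.card - 1 : ℕ) : ℝ) = S.card - 1 := by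
    rw [Nat.cast_sub (Finset.card_pos.2 ⟨v, hv⟩), Nat.cast_one]
  have h := bernProb_card_ge_le hp ((S.erase v).image fun u => s(v, u)) (r := r) (δ := δ)
    (by
      intro e he
      obtain ⟨u, hu, rfl⟩ := Finset.mem_image.1 he
      exact hr u (Finset.mem_of_mem_erase hu) (Finset.ne_of_mem_erase hu)) hr0 hr1 hδ0 hδ
  rw [hcard, hcast] at h
  refine (bernProb_mono hp fun f hf => ?_).trans h
  have hd : (((S.erase v).image fun u => s(v, u)).filter fun e => f e = true).card =
      degreeIn f S v := by
    rw [Finset.filter_image, Finset.card_image_of_injOn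
      (hinj.mono (Finset.coe_subset.2 (Finset.filter_subset _ _)))]
    rfl
  simp only [Set.mem_ofPred_eq, hd]
  refine ht.trans ?_
  exact_mod_cast le_of_lt hf

end DependentSets

section DependentSetLowerBound

set_option linter.unusedSectionVars false

variable {V : Type*} [Fintype V] [DecidableEq V]

lemma bernWeight_eq_mul {E : Type*} [Fintype E] [DecidableEq E] (s : Finset E) {p r : ℝ}
    (hr0 : 0 < r) (hr1 : r < 1) (f : E → Bool) :
    bernWeight (fun _ => p) f = bernWeight (fun e => if e ∈ s then r else p) f *
      ((p / r) ^ (s.filter fun e => f e = true).card *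
        ((1 - p) / (1 - r)) ^ (s.filter fun e => ¬ f e = true).card) := by
  have h1 : (p / r) ^ (s.filter fun e => f e = true).card *
        ((1 - p) / (1 - r)) ^ (s.filter fun e => ¬ f e = true).card =
      ∏ e, if e ∈ s then (if f e = true then p / r else (1 - p) / (1 - r)) else 1 := by
    rw [Finset.prod_ite_mem, Finset.univ_inter, Finset.prod_ite, Finset.prod_const,
      Finset.prod_const]
  have hr1' : 1 - r ≠ 0 := by linarith
  rw [h1, bernWeight, bernWeight, ← Finset.prod_mul_distrib]
  refine Finset.prod_congr rfl fun e _ => ?_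
  by_cases he : e ∈ s <;> by_cases hf : f e = true <;> simp [he, hf] <;> field_simp

lemma mul_le_bernProb_degreeLeEvent {p r δ ζ : ℝ} (hp1 : p < 1) (hr0 : 0 < r)
    (hrp : r < p) (hδ0 : 0 ≤ δ) (hδ1 : δ ≤ 1) (hζ0 : 0 ≤ ζ) (hζ1 : ζ ≤ 1) {T : Finset V} {t : ℕ}
    (ht : (r + δ) * (T.card - 1) ≤ t)
    (hsmall : T.card * Real.exp (-(δ ^ 2 / 4 * (T.card - 1))) +
      Real.exp (-(ζ ^ 2 / 4 * T.card.choose 2)) ≤ 1 / 2) :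
    1 / 2 * Real.exp (-(T.card.choose 2 * LambdaStar p r +
        ζ * T.card.choose 2 * (Real.log (p / r) - Real.log ((1 - p) / (1 - r))))) ≤
      bernProb (fun _ => p) (degreeLeEvent t T T) := by
  have hp0 : 0 < p := hr0.trans hrp
  have hr1 : r < 1 := hrp.trans hp1
  set a := Real.log (p / r) with ha
  set b := Real.log ((1 - p) / (1 - r)) with hb
  have ha0 : 0 ≤ a := Real.log_nonneg ((one_le_div hr0).2 hrp.le)
  have hb0 : b ≤ 0 := Real.log_nonpos (div_nonneg (by linarith) (by linarith))
    ((div_le_one (by linarith)).2 (by linarith))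
  have hΛ : LambdaStar p r = -(r * a) - (1 - r) * b := by
    rw [LambdaStar, ha, hb, ← inv_div r p, ← inv_div (1 - r) (1 - p), Real.log_inv, Real.log_inv]
    ring
  set N : ℝ := (T.card.choose 2 : ℝ) with hN
  let p' : Sym2 V → ℝ := fun e => if e ∈ pairsIn T then r else p
  have hp' : ∀ e, 0 ≤ p' e ∧ p' e ≤ 1 := by
    intro e
    simp only [p']
    split_ifs <;> constructor <;> linarith
  have hNcard : ((pairsIn T).card : ℝ) = N := by rw [card_pairsIn]
  let B : Set (Sym2 V → Bool) := degreeLeEvent t T T \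
    {f | (((pairsIn T).filter fun e => f e = true).card : ℝ) ≤ (r - ζ) * (pairsIn T).card}
  have hBc : bernProb p' Bᶜ ≤ 1 / 2 := by
    have hsub : Bᶜ ⊆ (⋃ v ∈ T, {f | t < degreeIn f T v}) ∪
        {f | (((pairsIn T).filter fun e => f e = true).card : ℝ) ≤
          (r - ζ) * (pairsIn T).card} := by
      intro f hf
      by_cases h : f ∈ degreeLeEvent t T T
      · right
        by_contra h'
        exact hf ⟨h, h'⟩
      · left
        simp only [degreeLeEvent, Set.mem_ofPred_eq, not_forall, not_le] at h
        obtain ⟨v, hv, hvt⟩ := h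
        exact Set.mem_iUnion₂.2 ⟨v, hv, hvt⟩
    refine (bernProb_mono hp' hsub).trans ((bernProb_union_le hp' _ _).trans
      (le_trans (add_le_add ?_ ?_) hsmall))
    · refine (bernProb_biUnion_le hp' _ _).trans ?_
      rw [← nsmul_eq_mul]
      refine Finset.sum_le_card_nsmul _ _ _ fun v hv => ?_
      refine bernProb_lt_degreeIn_le hp' hr0.le hr1.le hδ0 hδ1 hv (fun u hu huv => ?_) ht
      simp only [p', if_pos (mk_mem_pairsIn.2 ⟨hv, hu, huv.symm⟩)]
    · have := bernProb_card_le_le hp' (pairsIn T) (r := r) (δ := ζ)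
        (fun e he => by simp only [p', if_pos he]) hr0.le hr1.le hζ0 hζ1
      simpa only [hNcard] using this
  have hB : 1 / 2 ≤ bernProb p' B := by
    rw [bernProb_compl] at hBc
    linarith
  refine le_trans ?_ (bernProb_mono (fun _ => ⟨hp0.le, hp1.le⟩) (A := B) Set.sdiff_subset)
  calc _ ≤ bernProb p' B * Real.exp (-(N * LambdaStar p r + ζ * N * (a - b))) := by gcongr
    _ ≤ _ := by
      rw [bernProb, bernProb, bernExp, bernExp, Finset.sum_mul]
      refine Finset.sum_le_sum fun f _ => ?_
      by_cases hf : f ∈ B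
      · rw [Set.indicator_of_mem hf, mul_one, mul_one, bernWeight_eq_mul (pairsIn T) hr0 hr1]
        refine mul_le_mul_of_nonneg_left ?_ (bernWeight_nonneg hp' f)
        rw [← Real.exp_log (div_pos hp0 hr0),
          ← Real.exp_log (div_pos (by linarith : 0 < 1 - p) (by linarith : 0 < 1 - r)),
          ← Real.exp_nat_mul, ← Real.exp_nat_mul, ← Real.exp_add, Real.exp_le_exp, ← ha, ← hb]
        have h1 := Finset.card_filter_add_card_filter_not (s := pairsIn T) (fun e => f e = true)
        have h2 : (((pairsIn T).filter fun e => f e = true).card : ℝ) +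
            ((pairsIn T).filter fun e => ¬ f e = true).card = N := by
          rw [← hNcard]
          exact_mod_cast h1
        have h3 := hf.2
        rw [Set.mem_ofPred_eq, not_le, hNcard] at h3
        set X : ℝ := (((pairsIn T).filter fun e => f e = true).card : ℝ)
        rw [eq_sub_of_add_eq' h2, hΛ]
        nlinarith [mul_le_mul_of_nonneg_right h3.le (by linarith : 0 ≤ a - b)]
      · rw [Set.indicator_of_notMem hf, mul_zero, mul_zero, zero_mul]

lemma exists_forall_exp_le_bernProb_degreeLeEvent {p : ℝ} (hp0 : 0 < p) (hp1 : p < 1) {η : ℝ}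
    (hη : 0 < η) :
    ∃ k₀ : ℕ, ∀ (n t : ℕ) (T : Finset (Fin n)), k₀ ≤ T.card →
      Real.exp (-(T.card * (T.card - 1) / 2 * LambdaStar p (min (t / (T.card - 1)) p) +
        η * (T.card : ℝ) ^ 2)) ≤ bernProb (fun _ => p) (degreeLeEvent t T T) := by
  obtain ⟨δ₀, hδ₀, hΛc⟩ := exists_abs_LambdaStar_sub_le hp0 hp1 (half_pos hη)
  set δ := min δ₀ 1 with hδ
  have hδ0 : 0 < δ := lt_min hδ₀ one_pos
  have hδ1 : δ ≤ 1 := min_le_right _ _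
  set c := Real.log (p / (δ / 2)) - Real.log (1 - p) with hc
  set ζ := min 1 (η / (4 * (|c| + 1))) with hζ
  have hζ0 : 0 < ζ := lt_min one_pos (by positivity)
  have hζc : ζ * c ≤ η / 4 := by
    have h1 : ζ * (|c| + 1) ≤ η / 4 := by
      calc ζ * (|c| + 1) ≤ η / (4 * (|c| + 1)) * (|c| + 1) := by
            gcongr
            exact min_le_right _ _
        _ = η / 4 := by field_simp
    nlinarith [le_abs_self c]
  have hlim1 : Tendsto (fun k : ℕ => (k : ℝ) * Real.exp (-((δ / 2) ^ 2 / 4 * ((k : ℝ) - 1))))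
      atTop (nhds 0) := by
    have h1 : 0 < (δ / 2) ^ 2 / 4 := by positivity
    set b := (δ / 2) ^ 2 / 4
    have h2 := ((Real.tendsto_pow_mul_exp_neg_atTop_nhds_zero 1).comp
      (tendsto_natCast_atTop_atTop.const_mul_atTop h1)).const_mul (Real.exp b / b)
    rw [mul_zero] at h2
    refine h2.congr fun k => ?_
    simp only [Function.comp_apply, pow_one]
    rw [show -(b * ((k : ℝ) - 1)) = b + -(b * k) by ring, Real.exp_add]
    field_simp
  have hlim2 : Tendsto (fun k : ℕ => Real.exp (-(ζ ^ 2 / 4 * (k.choose 2 : ℝ))))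
      atTop (nhds 0) := by
    have h1 : 0 < ζ ^ 2 / 4 := by positivity
    refine Real.tendsto_exp_neg_atTop_nhds_zero.comp ?_
    refine (tendsto_atTop_mono' _ ?_ (tendsto_natCast_atTop_atTop (R := ℝ))).const_mul_atTop h1
    filter_upwards [eventually_ge_atTop 3] with k hk
    have hk' : (3 : ℝ) ≤ k := by exact_mod_cast hk
    rw [Nat.cast_choose_two]
    nlinarith
  have hev := ((hlim1.add hlim2).eventually (ge_mem_nhds (by norm_num : (0 : ℝ) + 0 < 1 / 2)))
  have hev2 : ∀ᶠ k : ℕ in atTop, Real.log 2 ≤ η / 4 * (k : ℝ) ^ 2 :=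
    (((tendsto_pow_atTop two_ne_zero).comp
      (tendsto_natCast_atTop_atTop (R := ℝ))).const_mul_atTop
        (by positivity : 0 < η / 4)).eventually_ge_atTop _
  obtain ⟨k₀, hk₀⟩ := eventually_atTop.1 ((hev.and hev2).and (eventually_ge_atTop 2))
  refine ⟨k₀, fun n t T hT => ?_⟩
  obtain ⟨⟨hsmall, hlog⟩, hk2⟩ := hk₀ T.card hT
  have hk2' : (2 : ℝ) ≤ T.card := by exact_mod_cast hk2
  have hkc : (T.card.choose 2 : ℝ) = T.card * (T.card - 1) / 2 := Nat.cast_choose_two ℝ _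
  rw [← hkc]
  have hN : (T.card.choose 2 : ℝ) ≤ (T.card : ℝ) ^ 2 / 2 := by rw [hkc]; nlinarith
  have hN0 : (0 : ℝ) ≤ T.card.choose 2 := Nat.cast_nonneg _
  set N : ℝ := (T.card.choose 2 : ℝ)
  set k : ℝ := (T.card : ℝ)
  set y : ℝ := min (t / (k - 1)) p with hy
  have hy0 : 0 ≤ y := le_min (div_nonneg (Nat.cast_nonneg _) (by linarith)) hp0.le
  have hyp : y ≤ p := min_le_right _ _
  rcases le_or_gt y δ with hyδ | hyδ
  · have h1 := hΛc 0 ⟨le_rfl, zero_le_one⟩ y ⟨hy0, by linarith⟩ (by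
      rw [zero_sub, abs_neg, abs_of_nonneg hy0]
      exact hyδ.trans (min_le_left _ _))
    rw [LambdaStar_zero] at h1
    calc Real.exp (-(N * LambdaStar p y + η * k ^ 2))
        ≤ Real.exp (N * Real.log (1 - p)) := Real.exp_le_exp.2 (by nlinarith)
      _ = (1 - p) ^ (pairsIn T).card := by
        rw [card_pairsIn, ← Real.rpow_natCast, Real.rpow_def_of_pos (by linarith), mul_comm]
      _ ≤ _ := by
        rw [← bernProb_forall_false]
        refine bernProb_mono (fun _ => ⟨hp0.le, hp1.le⟩) fun f hf v hv => ?_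
        have : degreeIn f T v = 0 := by
          rw [degreeIn, Finset.card_eq_zero, Finset.filter_eq_empty_iff]
          intro u hu
          rw [hf _ (mk_mem_pairsIn.2 ⟨hv, Finset.mem_of_mem_erase hu,
            (Finset.ne_of_mem_erase hu).symm⟩)]
          simp
        omega
  · have hr0 : δ / 2 ≤ y - δ / 2 := by linarith
    have ht : (y - δ / 2 + δ / 2) * (k - 1) ≤ t := by
      rw [sub_add_cancel, ← le_div_iff₀ (by linarith)]
      exact min_le_left _ _
    have h1 := mul_le_bernProb_degreeLeEvent hp1 (by linarith) (by linarith : y - δ / 2 < p)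
      (by linarith : 0 ≤ δ / 2) (by linarith) hζ0.le (min_le_left _ _) ht hsmall
    refine le_trans ?_ h1
    have h2 := hΛc (y - δ / 2) ⟨by linarith, by linarith⟩ y ⟨hy0, by linarith⟩ (by
      rw [sub_sub_cancel_left, abs_neg, abs_of_pos (by linarith)]
      have : δ ≤ δ₀ := min_le_left _ _
      linarith)
    have h3 : Real.log (p / (y - δ / 2)) - Real.log ((1 - p) / (1 - (y - δ / 2))) ≤ c := by
      rw [hc]
      refine sub_le_sub (Real.log_le_log (div_pos hp0 (by linarith)) (by gcongr))
        (Real.log_le_log (by linarith) ?_)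
      rw [le_div_iff₀ (by linarith)]
      nlinarith
    have h4 : (1 / 2 : ℝ) = Real.exp (-Real.log 2) := by
      rw [Real.exp_neg, Real.exp_log two_pos, one_div]
    rw [h4, ← Real.exp_add, Real.exp_le_exp]
    have h5 := mul_le_mul_of_nonneg_left h2 hN0
    have h6 := mul_le_mul_of_nonneg_left h3 (mul_nonneg hζ0.le hN0)
    have h7 : ζ * N * c ≤ η / 4 * N := by nlinarith
    nlinarith

end DependentSetLowerBound

section SecondMoment

lemma choose_sub_mul_pow_le {m k ℓ : ℕ} (hkm : k ≤ m) (hℓ : ℓ ≤ k) :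
    (m - ℓ).choose (k - ℓ) * m ^ ℓ ≤ k ^ ℓ * m.choose k := by
  induction ℓ with
  | zero => simp
  | succ ℓ ih =>
    have ih' := ih (by omega)
    obtain ⟨a, ha⟩ : ∃ a, m - ℓ = a + 1 := ⟨m - ℓ - 1, by omega⟩
    obtain ⟨b, hb⟩ : ∃ b, k - ℓ = b + 1 := ⟨k - ℓ - 1, by omega⟩
    rw [ha, hb] at ih'
    rw [show m - (ℓ + 1) = a by omega, show k - (ℓ + 1) = b by omega]
    have h1 := Nat.add_one_mul_choose_eq a b
    have h2 : (b + 1) * m ≤ (a + 1) * k := by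
      have hm : m = a + 1 + ℓ := by omega
      have hk : k = b + 1 + ℓ := by omega
      have hba : b ≤ a := by omega
      rw [hm, hk]
      nlinarith [Nat.mul_le_mul_right ℓ hba]
    refine Nat.le_of_mul_le_mul_left (c := a + 1) ?_ (Nat.succ_pos _)
    calc (a + 1) * (a.choose b * m ^ (ℓ + 1)) = ((a + 1) * a.choose b) * m * m ^ ℓ := by ring
      _ = (a + 1).choose (b + 1) * m ^ ℓ * ((b + 1) * m) := by rw [h1]; ring
      _ ≤ (k ^ ℓ * m.choose k) * ((a + 1) * k) := by gcongr
      _ = _ := by ring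

lemma card_filter_card_inter_eq_le {V : Type*} [DecidableEq V] (W S : Finset V) {k : ℕ}
    (hS : S.card = k) (ℓ : ℕ) :
    ((W.powersetCard k).filter fun T => (S ∩ T).card = ℓ).card ≤
      k.choose ℓ * (W.card - ℓ).choose (k - ℓ) := by
  have hsub : ((W.powersetCard k).filter fun T => (S ∩ T).card = ℓ) ⊆
      (S.powersetCard ℓ).biUnion fun I => (W.powersetCard k).filter fun T => I ⊆ T := by
    intro T hT
    rw [Finset.mem_filter] at hT
    exact Finset.mem_biUnion.2 ⟨S ∩ T, Finset.mem_powersetCard.2 ⟨Finset.inter_subset_left, hT.2⟩,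
      Finset.mem_filter.2 ⟨hT.1, Finset.inter_subset_right⟩⟩
  refine (Finset.card_le_card hsub).trans ?_
  rw [← hS, ← Finset.card_powersetCard ℓ S, hS]
  refine Finset.card_biUnion_le_card_mul _ _ _ fun I hI => ?_
  have hIc := (Finset.mem_powersetCard.1 hI).2
  by_cases hIW : I ⊆ W
  · rw [← hIc, ← Finset.card_sdiff_of_subset hIW, ← Finset.card_powersetCard]
    refine Finset.card_le_card_of_injOn (fun T => T \ I) (fun T hT => ?_) fun T hT T' hT' h => ?_
    · rw [Finset.mem_coe, Finset.mem_filter, Finset.mem_powersetCard] at hT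
      rw [Finset.mem_coe, Finset.mem_powersetCard, Finset.card_sdiff_of_subset hT.2, hT.1.2]
      exact ⟨Finset.sdiff_subset_sdiff hT.1.1 subset_rfl, rfl⟩
    · rw [Finset.mem_coe, Finset.mem_filter] at hT hT'
      rw [← Finset.sdiff_union_of_subset hT.2, ← Finset.sdiff_union_of_subset hT'.2]
      exact congrArg (· ∪ I) h
  · rw [Finset.filter_false_of_mem, Finset.card_empty]
    · exact Nat.zero_le _
    · exact fun T hT hIT => hIW (hIT.trans (Finset.mem_powersetCard.1 hT).1)

lemma card_filter_card_inter_eq_le_pow {V : Type*} [DecidableEq V] {W S : Finset V} {k ℓ : ℕ}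
    (hS : S.card = k) (hk : 0 < k) (hkW : k ≤ W.card) (hℓ : ℓ ≤ k) :
    (((W.powersetCard k).filter fun T => (S ∩ T).card = ℓ).card : ℝ) ≤
      ((k : ℝ) ^ 2 / W.card) ^ ℓ * W.card.choose k := by
  have hm : (0 : ℝ) < W.card := by exact_mod_cast hk.trans_le hkW
  have h1 : (((W.powersetCard k).filter fun T => (S ∩ T).card = ℓ).card : ℝ) ≤
      k.choose ℓ * (W.card - ℓ).choose (k - ℓ) := by
    exact_mod_cast card_filter_card_inter_eq_le W S hS ℓ
  have h2 : ((W.card - ℓ).choose (k - ℓ) : ℝ) * (W.card : ℝ) ^ ℓ ≤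
      (k : ℝ) ^ ℓ * W.card.choose k := by
    exact_mod_cast choose_sub_mul_pow_le hkW hℓ
  have h3 : (k.choose ℓ : ℝ) ≤ (k : ℝ) ^ ℓ := by exact_mod_cast Nat.choose_le_pow k ℓ
  refine h1.trans ?_
  rw [div_pow, div_mul_eq_mul_div, le_div_iff₀ (pow_pos hm _)]
  calc (k.choose ℓ : ℝ) * (W.card - ℓ).choose (k - ℓ) * (W.card : ℝ) ^ ℓ
      = k.choose ℓ * ((W.card - ℓ).choose (k - ℓ) * (W.card : ℝ) ^ ℓ) := by ring
    _ ≤ (k : ℝ) ^ ℓ * ((k : ℝ) ^ ℓ * W.card.choose k) := by gcongr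
    _ = _ := by ring

lemma bernProb_biInter_compl_degreeLeEvent_le {n : ℕ} {p : ℝ} (hp : 0 ≤ p ∧ p ≤ 1) {k t : ℕ}
    {W : Finset (Fin n)} (hk : 0 < k) (hkW : k ≤ W.card) {r : ℕ → ℝ} {B ρ : ℝ}
    (hr0 : ∀ ℓ, 0 ≤ r ℓ)
    (hr : ∀ S T : Finset (Fin n), S.card = k → T.card = k → 2 ≤ (S ∩ T).card →
      bernProb (fun _ => p) (degreeLeEvent t S S ∩ degreeLeEvent t T T) ≤ r (S ∩ T).card *
        (bernProb (fun _ => p) (degreeLeEvent t S S) * bernProb (fun _ => p) (degreeLeEvent t T T)))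
    (hB0 : 0 < B) (hB : ∀ ℓ, 2 ≤ ℓ → ℓ ≤ k → r ℓ * ((k : ℝ) ^ 2 / W.card) ^ ℓ ≤ B)
    (hρ : 0 < ρ)
    (hρT : ∀ T : Finset (Fin n), T.card = k → ρ ≤ bernProb (fun _ => p) (degreeLeEvent t T T))
    (hM : 1 ≤ 2 * W.card.choose k * (k * B) * ρ) :
    bernProb (fun _ => p) (⋂ T ∈ W.powersetCard k, (degreeLeEvent t T T)ᶜ) ≤
      Real.exp (-(1 / (4 * (k * B)))) := by
  have hcard : ∀ T ∈ W.powersetCard k, T.card = k := fun T hT => (Finset.mem_powersetCard.1 hT).2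
  refine bernProb_biInter_compl_le_exp_neg (s := fun T => (pairsIn T : Set _)) (D := k * B) (ρ := ρ)
    (R := fun S T => if 2 ≤ (S ∩ T).card then r (S ∩ T).card else 0)
    (fun _ => hp) (fun T => isLowerSet_degreeLeEvent t T T)
    (fun T => dependsOn_degreeLeEvent_pairsIn t T) (fun S T => ?_) (fun S hS T hT hST hdis => ?_)
    (by positivity) hρ (fun T hT => hρT T (hcard T hT)) ?_ ?_
  · split_ifs
    exacts [hr0 _, le_rfl]
  · have h2 : 2 ≤ (S ∩ T).card := by
      rw [Finset.disjoint_coe, Finset.not_disjoint_iff] at hdis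
      obtain ⟨e, heS, heT⟩ := hdis
      induction e using Sym2.ind with
      | _ u v =>
        rw [mk_mem_pairsIn] at heS heT
        exact Finset.one_lt_card.2 ⟨u, Finset.mem_inter.2 ⟨heS.1, heT.1⟩, v,
          Finset.mem_inter.2 ⟨heS.2.1, heT.2.1⟩, heS.2.2⟩
    rw [if_pos h2]
    exact hr S T (hcard S hS) (hcard T hT) h2
  · rw [sq, ← mul_assoc, mul_comm, ← nsmul_eq_mul]
    refine Finset.sum_le_card_nsmul _ _ _ fun S hS => ?_
    calc ∑ T ∈ (W.powersetCard k).erase S, (if 2 ≤ (S ∩ T).card then r (S ∩ T).card else 0)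
        ≤ ∑ T ∈ W.powersetCard k, (if 2 ≤ (S ∩ T).card then r (S ∩ T).card else 0) := by
          refine Finset.sum_le_sum_of_subset_of_nonneg (Finset.erase_subset _ _) fun _ _ _ => ?_
          split_ifs
          exacts [hr0 _, le_rfl]
      _ = ∑ ℓ ∈ Finset.range (k + 1),
            ∑ T ∈ (W.powersetCard k).filter fun T => (S ∩ T).card = ℓ,
              (if 2 ≤ (S ∩ T).card then r (S ∩ T).card else 0) := by
          rw [Finset.sum_fiberwise_of_maps_to]
          intro T hT
          rw [Finset.mem_range, Nat.lt_succ_iff, ← hcard T hT]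
          exact Finset.card_le_card Finset.inter_subset_right
      _ = ∑ ℓ ∈ Finset.range (k + 1),
            ((W.powersetCard k).filter fun T => (S ∩ T).card = ℓ).card *
              (if 2 ≤ ℓ then r ℓ else 0) := by
          refine Finset.sum_congr rfl fun ℓ _ => ?_
          rw [← nsmul_eq_mul]
          refine Finset.sum_eq_card_nsmul fun T hT => ?_
          rw [(Finset.mem_filter.1 hT).2]
      _ ≤ ∑ ℓ ∈ Finset.range (k + 1), (if 2 ≤ ℓ then B * W.card.choose k else 0) := by
          refine Finset.sum_le_sum fun ℓ hℓ => ?_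
          split_ifs with h2
          · have hℓk : ℓ ≤ k := Nat.lt_succ_iff.1 (Finset.mem_range.1 hℓ)
            calc _ ≤ ((k : ℝ) ^ 2 / W.card) ^ ℓ * W.card.choose k * r ℓ :=
                  mul_le_mul_of_nonneg_right
                    (card_filter_card_inter_eq_le_pow (hcard S hS) hk hkW hℓk) (hr0 ℓ)
              _ = r ℓ * ((k : ℝ) ^ 2 / W.card) ^ ℓ * W.card.choose k := by ring
              _ ≤ _ := by
                gcongr
                exact hB ℓ h2 hℓk
          · simp
      _ ≤ k * (B * W.card.choose k) := by
          rw [← Finset.sum_filter, ← nsmul_eq_mul, Finset.sum_const]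
          refine nsmul_le_nsmul_left (by positivity) ?_
          calc _ ≤ (Finset.Icc 1 k).card := Finset.card_le_card fun ℓ hℓ => by
                rw [Finset.mem_filter, Finset.mem_range] at hℓ
                rw [Finset.mem_Icc]
                omega
            _ = k := by simp
      _ = _ := by rw [Finset.card_powersetCard]; ring
  · rw [Finset.card_powersetCard]
    linarith [hM]

set_option maxHeartbeats 800000 in
/-- If `k`-sets are expected to be `t`-dependent with a probability that is polynomially larger
than the inverse of their number, then the probability that a large vertex set `W` spans no
`t`-dependent `k`-set is superexponentially small. -/
lemma exists_bernProb_biInter_compl_degreeLeEvent_le {p : ℝ} (hp0 : 0 < p) (hp1 : p < 1)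
    {ε K : ℝ} (hε0 : 0 < ε) (hε1 : ε ≤ 1 / 2) (hK : 0 < K) :
    ∃ k₀ : ℕ, ∀ (n t k : ℕ) (W : Finset (Fin n)) (L : ℝ), k₀ ≤ k → 0 < L → k ≤ K * L →
      ((k : ℝ) - 1) / 2 * LambdaStar p (min (t / ((k : ℝ) - 1)) p) ≤ (1 - ε) * L →
      (k : ℝ) ^ 2 ≤ W.card * Real.exp (-((1 - ε / 4) * L)) →
      bernProb (fun _ => p) (⋂ T ∈ W.powersetCard k, (degreeLeEvent t T T)ᶜ) ≤
        Real.exp (-(Real.exp (3 / 2 * L) / (4 * k))) := by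
  have hq : 0 < -Real.log (1 - p) := neg_pos.2 (Real.log_neg (by linarith) (by linarith))
  set a := -Real.log (1 - p) with ha
  set δ := min 1 (1 / (4 * K * a)) with hδ
  have hδ0 : 0 < δ := lt_min one_pos (by positivity)
  have hδ1 : δ ≤ 1 := min_le_left _ _
  have hδa : a * (δ * K) ≤ 1 / 4 := by
    calc a * (δ * K) ≤ a * (1 / (4 * K * a) * K) := by
          gcongr
          exact min_le_right _ _
      _ = 1 / 4 := by field_simp
  set η := ε * δ / (4 * K) with hη
  have hη0 : 0 < η := by positivity
  obtain ⟨k₁, hk₁⟩ := exists_forall_exp_le_bernProb_degreeLeEvent hp0 hp1 hη0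
  obtain ⟨k₂, hk₂⟩ := exists_nat_ge (3 / (ε * δ))
  refine ⟨max (max k₁ k₂) (max 2 ⌈3 / ε⌉₊), fun n t k W L hk hL hkL hΛ hW => ?_⟩
  have hkk₁ : k₁ ≤ k := by omega
  have hk2 : 2 ≤ k := by omega
  have hkε : 3 ≤ ε * k := by
    have h1 : 3 / ε ≤ k := (Nat.le_ceil _).trans (by
      have : ⌈3 / ε⌉₊ ≤ k := by omega
      exact_mod_cast this)
    rwa [div_le_iff₀ hε0, mul_comm] at h1
  have hkδ : 3 ≤ ε * δ * k := by
    have h1 : 3 / (ε * δ) ≤ k := hk₂.trans (by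
      have : k₂ ≤ k := by omega
      exact_mod_cast this)
    rwa [div_le_iff₀ (by positivity), mul_comm] at h1
  have hk0 : 0 < k := by omega
  have hk0' : (0 : ℝ) < k := by exact_mod_cast hk0
  have hk2' : (2 : ℝ) ≤ k := by exact_mod_cast hk2
  have hW0 : (0 : ℝ) < W.card := by
    by_contra h
    have : (W.card : ℝ) = 0 := le_antisymm (not_lt.1 h) (Nat.cast_nonneg _)
    rw [this, zero_mul] at hW
    nlinarith
  have hkW : k ≤ W.card := by
    have h1 : Real.exp (-((1 - ε / 4) * L)) ≤ 1 := Real.exp_le_one_iff.2 (by nlinarith)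
    have h2 : (k : ℝ) ≤ W.card := by nlinarith
    exact_mod_cast h2
  set x : ℝ := (k : ℝ) ^ 2 / W.card with hx
  have hx0 : 0 < x := by positivity
  have hxle : x ≤ Real.exp (-((1 - ε / 4) * L)) := by
    rwa [hx, div_le_iff₀ hW0, mul_comm]
  have hxpow : ∀ ℓ : ℕ, x ^ ℓ ≤ Real.exp (-((1 - ε / 4) * L * ℓ)) := fun ℓ => by
    calc x ^ ℓ ≤ Real.exp (-((1 - ε / 4) * L)) ^ ℓ := by gcongr
      _ = _ := by rw [← Real.exp_nat_mul]; ring_nf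
  set lam := LambdaStar p (min (t / ((k : ℝ) - 1)) p) with hlam
  set ρ := Real.exp (-(k * ((k : ℝ) - 1) / 2 * lam + η * (k : ℝ) ^ 2)) with hρ
  have hρT : ∀ T : Finset (Fin n), T.card = k →
      ρ ≤ bernProb (fun _ => p) (degreeLeEvent t T T) := fun T hT => by
    have := hk₁ n t T (hT ▸ hkk₁)
    rwa [hT] at this
  have hηk : η * (k : ℝ) ^ 2 ≤ ε * δ / 4 * L * k := by
    calc η * (k : ℝ) ^ 2 = η * k * k := by ring
      _ ≤ η * k * (K * L) := by gcongr
      _ = _ := by rw [hη]; field_simp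
  set r : ℕ → ℝ := fun ℓ => if (ℓ : ℝ) ≤ δ * k then Real.exp (a * (ℓ.choose 2))
    else Real.exp (ℓ * (((k : ℝ) - 1) / 2 * lam) + η * (k : ℝ) ^ 2) with hr
  have hp : 0 ≤ p ∧ p ≤ 1 := ⟨hp0.le, hp1.le⟩
  have main := bernProb_biInter_compl_degreeLeEvent_le (t := t) (r := r)
    (B := Real.exp (-(3 / 2 * L))) (ρ := ρ) hp hk0 hkW (fun ℓ => ?_) (fun S T hS hT h2 => ?_)
    (Real.exp_pos _) (fun ℓ h2 hℓk => ?_) (Real.exp_pos _) hρT ?_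
  · refine main.trans_eq ?_
    rw [Real.exp_neg (3 / 2 * L)]
    congr 2
    have := Real.exp_pos (3 / 2 * L)
    field_simp
  · simp only [hr]
    split_ifs <;> exact (Real.exp_pos _).le
  · simp only [hr]
    split_ifs with hℓ
    · have h1 := bernProb_degreeLeEvent_inter_mul_le hp t S T
      have h3 : (1 - p) ^ ((S ∩ T).card.choose 2) =
          (Real.exp (a * ((S ∩ T).card.choose 2)))⁻¹ := by
        rw [← Real.exp_neg, ← Real.rpow_natCast, Real.rpow_def_of_pos (by linarith), ha]
        ring_nf
      rw [h3, ← div_eq_mul_inv, div_le_iff₀ (Real.exp_pos _)] at h1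
      linarith
    · have h1 := bernProb_degreeLeEvent_inter_le hp t S T
      have h3 := bernProb_degreeLeEvent_le hp0 hp1 t (Finset.sdiff_subset : T \ S ⊆ T)
        (by omega)
      rw [hT, ← hlam] at h3
      have h4 : ((T \ S).card : ℝ) = k - (S ∩ T).card := by
        have := Finset.card_sdiff_add_card_inter T S
        rw [Finset.inter_comm, hT] at this
        rw [← this]
        push_cast
        ring
      have hPS := bernProb_nonneg (p := fun _ : Sym2 (Fin n) => p) (fun _ => hp)
        (degreeLeEvent t S S)
      calc _ ≤ _ := h1
        _ ≤ bernProb (fun _ => p) (degreeLeEvent t S S) *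
            (Real.exp ((S ∩ T).card * (((k : ℝ) - 1) / 2 * lam) + η * (k : ℝ) ^ 2) * ρ) := by
          refine mul_le_mul_of_nonneg_left (h3.trans ?_) hPS
          rw [hρ, ← Real.exp_add, Real.exp_le_exp, h4]
          apply le_of_eq
          ring
        _ ≤ bernProb (fun _ => p) (degreeLeEvent t S S) *
            (Real.exp ((S ∩ T).card * (((k : ℝ) - 1) / 2 * lam) + η * (k : ℝ) ^ 2) *
              bernProb (fun _ => p) (degreeLeEvent t T T)) := by
          gcongr
          exact hρT T hT
        _ = _ := by ring
  · have hℓ2 : (2 : ℝ) ≤ ℓ := by exact_mod_cast h2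
    have hLℓ : 0 < L * ℓ := by positivity
    simp only [hr]
    split_ifs with hℓ
    · have h1 : a * (ℓ.choose 2 : ℝ) ≤ 1 / 8 * (L * ℓ) := by
        have h3 : (ℓ.choose 2 : ℝ) ≤ ℓ * (δ * (K * L)) / 2 := by
          rw [Nat.cast_choose_two]
          have : (ℓ : ℝ) - 1 ≤ δ * (K * L) := by
            nlinarith [mul_le_mul_of_nonneg_left hkL hδ0.le]
          nlinarith
        calc a * (ℓ.choose 2 : ℝ) ≤ a * (ℓ * (δ * (K * L)) / 2) := by gcongr
          _ = a * (δ * K) * (L * ℓ) / 2 := by ring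
          _ ≤ 1 / 4 * (L * ℓ) / 2 := by gcongr
          _ = _ := by ring
      calc _ ≤ Real.exp (1 / 8 * (L * ℓ)) * Real.exp (-((1 - ε / 4) * L * ℓ)) := by
            gcongr
            exact hxpow ℓ
        _ ≤ _ := by
          rw [← Real.exp_add, Real.exp_le_exp]
          nlinarith
    · rw [not_le] at hℓ
      have hεL : 0 < ε * L := by positivity
      have h3 : η * (k : ℝ) ^ 2 ≤ ε / 4 * (L * ℓ) := by
        refine hηk.trans ?_
        nlinarith [mul_lt_mul_of_pos_left hℓ hεL]
      have h4 : Real.exp (ℓ * (((k : ℝ) - 1) / 2 * lam) + η * (k : ℝ) ^ 2) ≤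
          Real.exp (ℓ * ((1 - ε) * L) + ε / 4 * (L * ℓ)) :=
        Real.exp_le_exp.2 (add_le_add (mul_le_mul_of_nonneg_left hΛ (by positivity)) h3)
      refine (mul_le_mul h4 (hxpow ℓ) (pow_nonneg hx0.le _) (Real.exp_pos _).le).trans ?_
      rw [← Real.exp_add, Real.exp_le_exp]
      have h5 : 3 ≤ ε * ℓ := by nlinarith
      nlinarith [mul_le_mul_of_nonneg_right h5 hL.le]
  · have h1 : 1 ≤ x ^ k * W.card.choose k := by
      have h2 := choose_sub_mul_pow_le hkW le_rfl
      rw [Nat.sub_self, Nat.choose_zero_right, one_mul] at h2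
      have h3 : (W.card : ℝ) ^ k ≤ (k : ℝ) ^ k * W.card.choose k := by exact_mod_cast h2
      rw [hx, div_pow, div_mul_eq_mul_div, one_le_div (pow_pos hW0 _)]
      refine h3.trans (mul_le_mul_of_nonneg_right ?_ (Nat.cast_nonneg _))
      exact pow_le_pow_left₀ hk0'.le (by nlinarith) _
    have h2 : 1 ≤ Real.exp (-((1 - ε / 4) * L * k)) * W.card.choose k :=
      h1.trans (mul_le_mul_of_nonneg_right (hxpow k) (Nat.cast_nonneg _))
    have h3 : Real.exp (-((1 - ε / 4) * L * k)) ≤ Real.exp (-(3 / 2 * L)) * ρ := by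
      rw [hρ, ← Real.exp_add, Real.exp_le_exp]
      have h4 := mul_le_mul_of_nonneg_left hΛ hk0'.le
      have h5 : ε * δ / 4 * L * k ≤ ε / 4 * (L * k) := by
        have : 0 ≤ ε / 4 * (L * k) := by positivity
        nlinarith
      have h6 := mul_le_mul_of_nonneg_right hkε hL.le
      nlinarith
    have h4 := mul_le_mul_of_nonneg_right h3 (Nat.cast_nonneg (α := ℝ) (W.card.choose k))
    have h5 : 1 ≤ Real.exp (-(3 / 2 * L)) * ρ * W.card.choose k := h2.trans h4
    nlinarith

end SecondMoment

section ImproperColouring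

lemma IsTDependent.mono {V : Type*} [Finite V] {G : SimpleGraph V} {t : ℕ} {S T : Set V}
    (hT : IsTDependent G t T) (hST : S ⊆ T) : IsTDependent G t S := by
  intro v hv
  have h : {u ∈ S | G.Adj v u} ⊆ {u ∈ T | G.Adj v u} := fun _ hu => ⟨hST hu.1, hu.2⟩
  exact (Set.ncard_le_ncard h (Set.toFinite _)).trans (hT v (hST hv))

lemma isTDependent_of_subsingleton {V : Type*} {G : SimpleGraph V} {t : ℕ} {S : Set V}
    (hS : S.Subsingleton) : IsTDependent G t S := by
  intro v hv
  have : {u ∈ S | G.Adj v u} = ∅ :=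
    Set.eq_empty_of_forall_notMem fun u hu => hu.2.ne (hS hv hu.1)
  rw [this, Set.ncard_empty]
  exact Nat.zero_le _

lemma improperChromaticNumber_le {V : Type*} {G : SimpleGraph V} {t k : ℕ} (c : V → ℕ)
    (hc : ∀ v, c v < k) (hdep : ∀ i, IsTDependent G t {v | c v = i}) :
    improperChromaticNumber G t ≤ k := by
  refine Nat.sInf_le ⟨fun v => ⟨c v, hc v⟩, fun i => ?_⟩
  simpa only [Fin.ext_iff] using hdep i

lemma card_le_improperChromaticNumber_mul {V : Type*} [Fintype V] {G : SimpleGraph V} {t b : ℕ}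
    (hb : ∀ T : Finset V, IsTDependent G t T → T.card ≤ b) :
    Fintype.card V ≤ improperChromaticNumber G t * b := by
  classical
  have hne : {k | ∃ c : V → Fin k, ∀ i : Fin k, IsTDependent G t {v | c v = i}}.Nonempty :=
    ⟨Fintype.card V, Fintype.equivFin V, fun i => isTDependent_of_subsingleton fun u hu v hv =>
      (Fintype.equivFin V).injective (hu.trans hv.symm)⟩
  obtain ⟨c, hc⟩ := Nat.sInf_mem hne
  rw [← Finset.card_univ, mul_comm]
  refine (Finset.card_le_mul_card_image_of_maps_to (f := c) (t := Finset.univ)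
    (fun _ _ => Finset.mem_univ _) b fun i _ => hb _ ?_).trans_eq ?_
  · simpa using hc i
  · rw [Finset.card_univ, Fintype.card_fin]
    rfl

/-- Colour greedily with `t`-dependent `k`-sets as long as at least `m` vertices are left, then
give each remaining vertex its own colour. -/
lemma improperChromaticNumber_mul_le {V : Type*} [Fintype V] {G : SimpleGraph V} {t k m : ℕ}
    (h : ∀ W : Finset V, m ≤ W.card → ∃ T ⊆ W, T.card = k ∧ IsTDependent G t T) (hk : 0 < k) :
    improperChromaticNumber G t * k ≤ Fintype.card V + m * k := by
  classical
  have key : ∀ (N : ℕ) (W : Finset V), W.card = N → ∃ (j : ℕ) (c : V → ℕ),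
      (∀ v ∈ W, c v < j) ∧ (∀ i, IsTDependent G t {v | v ∈ W ∧ c v = i}) ∧
        j * k ≤ W.card + m * k := by
    intro N
    induction N using Nat.strong_induction_on with
    | _ N ih =>
      intro W hW
      rcases lt_or_ge W.card m with hm | hm
      · refine ⟨W.card, fun v => if hv : v ∈ W then W.equivFin ⟨v, hv⟩ else 0, fun v hv => ?_,
          fun i => isTDependent_of_subsingleton ?_, ?_⟩
        · simp only [hv, dif_pos, Fin.is_lt]
        · rintro u ⟨hu, hui⟩ v ⟨hv, hvi⟩
          simp only [dif_pos hu] at hui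
          simp only [dif_pos hv] at hvi
          have := W.equivFin.injective (Fin.ext (hui.trans hvi.symm))
          exact congrArg Subtype.val this
        · exact (Nat.mul_le_mul_right k hm.le).trans (Nat.le_add_left _ _)
      · obtain ⟨T, hTW, hTk, hT⟩ := h W hm
        have hcard := Finset.card_sdiff_add_card_eq_card hTW
        obtain ⟨j, c, hc, hdep, hj⟩ := ih (W \ T).card (by omega) (W \ T) rfl
        refine ⟨j + 1, fun v => if v ∈ T then j else c v, fun v hv => ?_, fun i => ?_, ?_⟩
        · by_cases hvT : v ∈ T
          · simp [hvT]
          · simpa [hvT] using (hc v (Finset.mem_sdiff.2 ⟨hv, hvT⟩)).trans (Nat.lt_succ_self j)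
        · rcases eq_or_ne i j with rfl | hij
          · refine hT.mono ?_
            rintro v ⟨hv, hvi⟩
            by_contra hvT
            rw [Finset.mem_coe] at hvT
            simp only [hvT, if_false] at hvi
            exact (hc v (Finset.mem_sdiff.2 ⟨hv, hvT⟩)).ne hvi
          · refine (hdep i).mono ?_
            rintro v ⟨hv, hvi⟩
            by_cases hvT : v ∈ T
            · simp only [hvT, if_true] at hvi
              exact absurd hvi.symm hij
            · simp only [hvT, if_false] at hvi
              exact ⟨Finset.mem_sdiff.2 ⟨hv, hvT⟩, hvi⟩
        · rw [add_mul, one_mul]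
          omega
  obtain ⟨j, c, hc, hdep, hj⟩ := key _ Finset.univ rfl
  refine (Nat.mul_le_mul_right k (improperChromaticNumber_le c (fun v => hc v (Finset.mem_univ v))
    fun i => ?_)).trans hj
  simpa using hdep i

end ImproperColouring

section RandomGraph

lemma isTDependent_fromEdgeSet_iff {V : Type*} [Fintype V] [DecidableEq V]
    (f : Sym2 V → Bool) (t : ℕ) (S : Finset V) :
    IsTDependent (SimpleGraph.fromEdgeSet {e | f e = true}) t (S : Set V) ↔
      f ∈ degreeLeEvent t S S := by
  refine forall₂_congr fun v _ => ?_
  rw [degreeIn, ← Set.ncard_coe_finset]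
  have : {u ∈ (S : Set V) | (SimpleGraph.fromEdgeSet {e | f e = true}).Adj v u} =
      ((S.erase v).filter fun u => f s(v, u) = true : Finset V) := by
    ext u
    simp only [SimpleGraph.fromEdgeSet_adj, Finset.coe_filter, Finset.mem_erase,
      Set.mem_ofPred_eq, Finset.mem_coe]
    tauto
  rw [this]

lemma bernoulliBool_singleton {p : ℝ} (b : Bool) :
    bernoulliBool p {b} = ENNReal.ofReal (if b then p else 1 - p) := by
  cases b <;> simp [bernoulliBool, ENNReal.ofReal]

lemma erMeasure_apply {n : ℕ} {p : ℝ} (hp : 0 ≤ p ∧ p ≤ 1) (E : Set (SimpleGraph (Fin n))) :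
    erMeasure n p E = ENNReal.ofReal (bernProb (fun _ => p)
      {f : Sym2 (Fin n) → Bool | SimpleGraph.fromEdgeSet {e | f e = true} ∈ E}) := by
  classical
  rw [erMeasure, Measure.map_apply Measurable.of_discrete (MeasurableSpace.measurableSet_top (s := E))]
  set A : Set (Sym2 (Fin n) → Bool) :=
    {f | SimpleGraph.fromEdgeSet {e | f e = true} ∈ E} with hA
  have hpre : (fun f : Sym2 (Fin n) → Bool => SimpleGraph.fromEdgeSet {e | f e = true}) ⁻¹' E =
      (A.toFinset : Set _) := by rw [Set.coe_toFinset]; rfl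
  rw [hpre, ← sum_measure_singleton, bernProb, bernExp,
    ENNReal.ofReal_sum_of_nonneg fun f _ => mul_nonneg (bernWeight_nonneg (fun _ => hp) f)
      (Set.indicator_nonneg (fun _ _ => zero_le_one) f)]
  rw [← Finset.sum_subset (Finset.subset_univ A.toFinset) fun f _ hf => by
    rw [Set.mem_toFinset] at hf
    rw [Set.indicator_of_notMem hf, mul_zero, ENNReal.ofReal_zero]]
  refine Finset.sum_congr rfl fun f hf => ?_
  rw [Set.mem_toFinset] at hf
  rw [Set.indicator_of_mem hf, mul_one, Measure.pi_singleton, bernWeight,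
    ENNReal.ofReal_prod_of_nonneg fun e _ => by split_ifs <;> linarith [hp.1, hp.2]]
  exact Finset.prod_congr rfl fun e _ => bernoulliBool_singleton _

end RandomGraph

section Asymptotics

lemma eventually_mul_pow_le_exp {b : ℝ} (hb : 0 < b) (c : ℝ) (k : ℕ) :
    ∀ᶠ x : ℝ in atTop, c * x ^ k ≤ Real.exp (b * x) := by
  have h := (isLittleO_pow_exp_pos_mul_atTop k hb).bound
    (show (0 : ℝ) < 1 / (|c| + 1) by positivity)
  filter_upwards [h, eventually_ge_atTop 0] with x hx hx0
  rw [Real.norm_of_nonneg (pow_nonneg hx0 k), Real.norm_of_nonneg (Real.exp_pos _).le,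
    div_mul_eq_mul_div, one_mul, le_div_iff₀ (by positivity)] at hx
  nlinarith [le_abs_self c, pow_nonneg hx0 k]

lemma bernProb_improperChromaticNumber_lt_le {p : ℝ} (hp0 : 0 < p) (hp1 : p < 1) {ε : ℝ}
    (hε : 0 < ε) :
    ∀ᶠ n : ℕ in atTop, ∀ (t : ℕ) (κ : ℝ), t / Real.log n / p < κ →
      κ / 2 * LambdaStar p (t / Real.log n / κ) = 1 →
      bernProb (fun _ => p) {f : Sym2 (Fin n) → Bool |
        (improperChromaticNumber (SimpleGraph.fromEdgeSet {e | f e = true}) t : ℝ) <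
          (1 - 2 * ε) * (n / (κ * Real.log n))} ≤ 1 / n := by
  have ha : 0 < -Real.log (1 - p) := neg_pos.2 (Real.log_neg (by linarith) (by linarith))
  have hLtop : Tendsto (fun n : ℕ => Real.log n) atTop atTop :=
    Real.tendsto_log_atTop.comp tendsto_natCast_atTop_atTop
  filter_upwards [hLtop.eventually_gt_atTop 0,
    hLtop.eventually_ge_atTop ((1 / ε) / (2 / -Real.log (1 - p))), eventually_ge_atTop 2]
    with n hL hL2 hn t κ hκ hκΛ
  have hn0 : (0 : ℝ) < n := by exact_mod_cast (by omega : 0 < n)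
  have hexp : Real.exp (Real.log n) = n := Real.exp_log hn0
  set L := Real.log n
  have hτ : 0 ≤ t / L := by positivity
  have hκ0 : 0 < κ := kappa_pos hp0 hτ hκ
  have hκa := le_kappa hp0 hp1 hτ hκ hκΛ
  set A := κ * L with hA
  have hA0 : 0 < A := by positivity
  have hAε : 1 ≤ ε * A := by
    rw [div_le_iff₀ (by positivity), div_le_iff₀ hε] at hL2
    nlinarith [mul_le_mul_of_nonneg_right hκa hL.le]
  set b := ⌈(1 + ε) * A⌉₊ with hb
  have hbA : (1 + ε) * A ≤ b := Nat.le_ceil _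
  have hb1 : (b : ℝ) ≤ (1 + 2 * ε) * A := by
    have := Nat.ceil_lt_add_one (by positivity : 0 ≤ (1 + ε) * A)
    linarith
  have hb0 : (0 : ℝ) < b := lt_of_lt_of_le (by positivity) hbA
  have hΛ : (1 + ε) * L ≤ b / 2 * LambdaStar p (min (t / b) p) := by
    have h1 := le_half_mul_LambdaStar hp0 hp1 hτ hκ hκΛ (c := 1 + ε) (κ' := b / L)
      (by linarith) (by rw [le_div_iff₀ hL]; linarith)
    have h2 : t / L / (b / L) = t / b := by field_simp
    rw [h2] at h1
    have h3 : t / (b : ℝ) ≤ p := by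
      rw [div_div, div_lt_iff₀ (by positivity)] at hκ
      rw [div_le_iff₀ hb0]
      nlinarith
    rw [min_eq_left h3]
    calc (1 + ε) * L ≤ b / L / 2 * LambdaStar p (t / b) * L := by gcongr
      _ = _ := by field_simp
  have hp : 0 ≤ p ∧ p ≤ 1 := ⟨hp0.le, hp1.le⟩
  have hsub : {f : Sym2 (Fin n) → Bool |
        (improperChromaticNumber (SimpleGraph.fromEdgeSet {e | f e = true}) t : ℝ) <
          (1 - 2 * ε) * (n / A)} ⊆
      ⋃ T ∈ (Finset.univ : Finset (Fin n)).powersetCard (b + 1), degreeLeEvent t T T := by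
    intro f hf
    by_contra hcon
    simp only [Set.mem_iUnion, not_exists] at hcon
    have h1 := card_le_improperChromaticNumber_mul
      (G := SimpleGraph.fromEdgeSet {e | f e = true}) (t := t) (b := b) fun T hT => by
        by_contra hTb
        obtain ⟨T', hT'T, hT'⟩ := Finset.exists_subset_card_eq (by omega : b + 1 ≤ T.card)
        exact hcon T' (Finset.mem_powersetCard.2 ⟨Finset.subset_univ _, hT'⟩)
          ((isTDependent_fromEdgeSet_iff f t T').1 (hT.mono (by exact_mod_cast hT'T)))
    rw [Fintype.card_fin] at h1
    have h2 : (n : ℝ) ≤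
        improperChromaticNumber (SimpleGraph.fromEdgeSet {e | f e = true}) t * b := by
      exact_mod_cast h1
    have hf' : (improperChromaticNumber (SimpleGraph.fromEdgeSet {e | f e = true}) t : ℝ) <
      (1 - 2 * ε) * (n / A) := hf
    set χ : ℝ := (improperChromaticNumber (SimpleGraph.fromEdgeSet {e | f e = true}) t : ℝ)
    have hχ0 : 0 ≤ χ := Nat.cast_nonneg _
    have h3 : χ * b < n := by
      calc χ * b ≤ χ * ((1 + 2 * ε) * A) := by gcongr
        _ < (1 - 2 * ε) * (n / A) * ((1 + 2 * ε) * A) := by gcongr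
        _ = (1 - 4 * ε ^ 2) * n := by field_simp; ring
        _ ≤ n := by nlinarith [sq_nonneg ε]
    linarith
  refine (bernProb_mono (fun _ => hp) hsub).trans ((bernProb_biUnion_le (fun _ => hp) _ _).trans ?_)
  have hterm : ∀ T ∈ (Finset.univ : Finset (Fin n)).powersetCard (b + 1),
      bernProb (fun _ => p) (degreeLeEvent t T T) ≤ Real.exp (-((b + 1) * ((1 + ε) * L))) := by
    intro T hT
    have hTc := (Finset.mem_powersetCard.1 hT).2
    have hb0' : 0 < b := by exact_mod_cast hb0
    have h1 := bernProb_degreeLeEvent_le hp0 hp1 t (subset_refl T) (by omega)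
    refine h1.trans (Real.exp_le_exp.2 (neg_le_neg ?_))
    rw [hTc]
    push_cast
    rw [add_sub_cancel_right]
    calc ((b : ℝ) + 1) * ((1 + ε) * L) ≤ (b + 1) * (b / 2 * LambdaStar p (min (t / b) p)) := by
          gcongr
      _ = _ := by ring
  refine (Finset.sum_le_card_nsmul _ _ _ hterm).trans ?_
  rw [Finset.card_powersetCard, Finset.card_univ, Fintype.card_fin, nsmul_eq_mul]
  have h1 : (n.choose (b + 1) : ℝ) ≤ Real.exp ((b + 1) * L) := by
    calc (n.choose (b + 1) : ℝ) ≤ (n : ℝ) ^ (b + 1) := by exact_mod_cast Nat.choose_le_pow n _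
      _ = _ := by rw [← hexp, ← Real.exp_nat_mul]; push_cast; rfl
  calc _ ≤ Real.exp ((b + 1) * L) * Real.exp (-((b + 1) * ((1 + ε) * L))) := by gcongr
    _ ≤ Real.exp (-L) := by
      rw [← Real.exp_add, Real.exp_le_exp]
      have : 1 ≤ ε * (b + 1) := by nlinarith
      nlinarith
    _ = 1 / n := by rw [Real.exp_neg, hexp, one_div]

set_option maxHeartbeats 1000000 in
lemma exists_bernProb_lt_improperChromaticNumber_le_of_large {p : ℝ} (hp0 : 0 < p) (hp1 : p < 1)
    {δ : ℝ} (hδ0 : 0 < δ) (hδ1 : δ ≤ 1) :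
    ∃ C > 0, ∃ c > 0, ∀ᶠ n : ℕ in atTop, ∀ (t : ℕ) (κ : ℝ), (t : ℝ) / n ≤ c →
      C ≤ t / Real.log n → t / Real.log n / p < κ →
      κ / 2 * LambdaStar p (t / Real.log n / κ) = 1 →
      bernProb (fun _ => p) {f : Sym2 (Fin n) → Bool | (1 + 4 * δ) * (n / (κ * Real.log n)) <
        (improperChromaticNumber (SimpleGraph.fromEdgeSet {e | f e = true}) t : ℝ)} ≤ 1 / n := by
  obtain ⟨C₁, hC₁, hκC⟩ := exists_kappa_le_mul_div hp0 hp1 hδ0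
  refine ⟨max C₁ (32 * p / (δ * p) ^ 2), lt_max_of_lt_left hC₁, δ * p / 4, by positivity, ?_⟩
  have hLtop : Tendsto (fun n : ℕ => Real.log n) atTop atTop :=
    Real.tendsto_log_atTop.comp tendsto_natCast_atTop_atTop
  filter_upwards [hLtop.eventually_ge_atTop 1, eventually_ge_atTop 2]
    with n hL hn t κ htn htC hκ hκΛ
  have hn2 : (2 : ℝ) ≤ n := by exact_mod_cast hn
  have hn0 : (0 : ℝ) < n := by linarith
  have hexp : Real.exp (Real.log n) = n := Real.exp_log hn0
  set L := Real.log n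
  have hL0 : 0 < L := by linarith
  have hτ : 0 ≤ t / L := by positivity
  have hκ0 : 0 < κ := kappa_pos hp0 hτ hκ
  set A := κ * L with hA
  have hA0 : 0 < A := by positivity
  have hAt : A ≤ (1 + δ) * (t / p) := by
    have h1 := hκC _ _ ((le_max_left _ _).trans htC) hκ hκΛ
    exact (mul_le_mul_of_nonneg_right h1 hL0.le).trans_eq (by field_simp)
  rw [div_le_iff₀ hn0] at htn
  have hAn : A ≤ δ * n := by
    refine hAt.trans ?_
    have h1 : (t : ℝ) / p ≤ δ / 4 * n := by
      rw [div_le_iff₀ hp0]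
      linarith
    have h2 : (0 : ℝ) ≤ t / p := by positivity
    nlinarith
  set b := ⌊(t : ℝ) / (p + δ * p)⌋₊ with hb
  have hpδ : 0 < p + δ * p := by positivity
  have hbt : (p + δ * p) * b ≤ t := by
    have := Nat.floor_le (by positivity : 0 ≤ (t : ℝ) / (p + δ * p))
    rwa [le_div_iff₀ hpδ, mul_comm] at this
  have htb : (t : ℝ) < (b + 1) * (p + δ * p) := by
    have := Nat.lt_floor_add_one ((t : ℝ) / (p + δ * p))
    rwa [div_lt_iff₀ hpδ] at this
  have hbL : 2 * L ≤ (δ * p) ^ 2 / 4 * b := by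
    have h1 := (le_max_right _ _).trans htC
    rw [div_le_div_iff₀ (by positivity) hL0] at h1
    have h2 : (t : ℝ) ≤ (b + 1) * (2 * p) := by nlinarith
    have h3 : 16 * L ≤ (b + 1) * (δ * p) ^ 2 := by
      have h4 : 0 ≤ (δ * p) ^ 2 := by positivity
      nlinarith [mul_le_mul_of_nonneg_right h2 h4]
    have h5 : (δ * p) ^ 2 ≤ 1 := by
      rw [sq_le_one_iff₀ (by positivity)]
      nlinarith
    nlinarith
  have hbn : b + 1 ≤ n := by
    have h1 : (b : ℝ) ≤ n / 4 := by
      by_contra h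
      rw [not_le] at h
      nlinarith
    have h2 : (b : ℝ) + 1 ≤ n := by linarith
    exact_mod_cast h2
  have hp : 0 ≤ p ∧ p ≤ 1 := ⟨hp0.le, hp1.le⟩
  have hT : ∀ v : Fin n, ∃ T : Finset (Fin n), T.card = b + 1 ∧
      ∀ u : Fin n, u.1 / (b + 1) = v.1 / (b + 1) → u ∈ T := by
    intro v
    have h1 : ((Finset.univ : Finset (Fin n)).filter
        fun u => u.1 / (b + 1) = v.1 / (b + 1)).card ≤ b + 1 := by
      calc _ = (((Finset.univ : Finset (Fin n)).filter
            fun u => u.1 / (b + 1) = v.1 / (b + 1)).map Fin.valEmbedding).card :=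
            (Finset.card_map _).symm
        _ ≤ (Finset.Ico (v.1 / (b + 1) * (b + 1)) (v.1 / (b + 1) * (b + 1) + (b + 1))).card := by
          refine Finset.card_le_card fun x hx => ?_
          rw [Finset.mem_map] at hx
          obtain ⟨u, hu, rfl⟩ := hx
          rw [Finset.mem_filter] at hu
          rw [← hu.2, Finset.mem_Ico]
          exact ⟨Nat.div_mul_le_self _ _, Nat.lt_div_mul_add (Nat.succ_pos b)⟩
        _ = b + 1 := by simp
    obtain ⟨T, hT1, hT2⟩ := Finset.exists_superset_card_eq h1 (by simpa using hbn)
    exact ⟨T, hT2, fun u hu => hT1 (Finset.mem_filter.2 ⟨Finset.mem_univ _, hu⟩)⟩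
  choose T hTc hTmem using hT
  have hsub : {f : Sym2 (Fin n) → Bool | (1 + 4 * δ) * (n / A) <
        (improperChromaticNumber (SimpleGraph.fromEdgeSet {e | f e = true}) t : ℝ)} ⊆
      ⋃ v ∈ (Finset.univ : Finset (Fin n)), {f | t < degreeIn f (T v) v} := by
    intro f hf
    by_contra hcon
    simp only [Set.mem_iUnion, not_exists, Set.mem_ofPred_eq, not_lt, Finset.mem_univ,
      forall_true_left] at hcon
    have h1 := improperChromaticNumber_le
      (G := SimpleGraph.fromEdgeSet {e | f e = true}) (t := t) (k := n / (b + 1) + 1)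
      (fun v : Fin n => v.1 / (b + 1))
      (fun v => Nat.lt_succ_of_le (Nat.div_le_div_right v.2.le)) fun i => by
        have h2 := (isTDependent_fromEdgeSet_iff f t
          ((Finset.univ : Finset (Fin n)).filter fun v => v.1 / (b + 1) = i)).2 fun v hv => by
            refine (degreeIn_subset (fun u hu => ?_) f v).trans (hcon v)
            rw [Finset.mem_filter] at hu hv
            exact hTmem v u (hu.2.trans hv.2.symm)
        simpa using h2
    have h2 : (improperChromaticNumber (SimpleGraph.fromEdgeSet {e | f e = true}) t : ℝ) ≤
        n / ((b : ℝ) + 1) + 1 := by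
      refine (Nat.cast_le.2 h1).trans ?_
      push_cast
      gcongr
      exact_mod_cast Nat.cast_div_le (α := ℝ) (m := n) (n := b + 1)
    have hf' : (1 + 4 * δ) * (n / A) <
      (improperChromaticNumber (SimpleGraph.fromEdgeSet {e | f e = true}) t : ℝ) := hf
    have h3 : A ≤ (1 + δ) ^ 2 * (b + 1) := by
      calc A ≤ (1 + δ) * (t / p) := hAt
        _ ≤ (1 + δ) * ((b + 1) * (p + δ * p) / p) := by gcongr
        _ = _ := by field_simp
    have h4 : n / ((b : ℝ) + 1) ≤ (1 + δ) ^ 2 * (n / A) := by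
      rw [← mul_div_assoc, div_le_div_iff₀ (by positivity) hA0]
      nlinarith
    have h5 : 1 ≤ δ * (n / A) := by
      rw [← mul_div_assoc, le_div_iff₀ hA0]
      linarith
    have h6 : 0 ≤ (n : ℝ) / A := by positivity
    nlinarith
  refine (bernProb_mono (fun _ => hp) hsub).trans ((bernProb_biUnion_le (fun _ => hp) _ _).trans ?_)
  have hterm : ∀ v ∈ (Finset.univ : Finset (Fin n)),
      bernProb (fun _ => p) {f | t < degreeIn f (T v) v} ≤ Real.exp (-(2 * L)) := by
    intro v _
    have h1 := bernProb_lt_degreeIn_le (p := fun _ => p) (r := p) (δ := δ * p) (t := t)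
      (S := T v) (v := v) (fun _ => hp) hp0.le hp1.le (by positivity) (by nlinarith)
      (hTmem v v rfl) (fun _ _ _ => rfl) (by rw [hTc]; push_cast; rwa [add_sub_cancel_right])
    refine h1.trans (Real.exp_le_exp.2 (neg_le_neg ?_))
    rw [hTc]
    push_cast
    rwa [add_sub_cancel_right]
  refine (Finset.sum_le_card_nsmul _ _ _ hterm).trans_eq ?_
  rw [Finset.card_univ, Fintype.card_fin, nsmul_eq_mul, two_mul, neg_add, Real.exp_add,
    Real.exp_neg, hexp]
  field_simp

set_option maxHeartbeats 1000000 in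
lemma bernProb_lt_improperChromaticNumber_le_of_bounded {p : ℝ} (hp0 : 0 < p) (hp1 : p < 1)
    {ε C : ℝ} (hε0 : 0 < ε) (hε1 : ε ≤ 1 / 4) :
    ∀ᶠ n : ℕ in atTop, ∀ (t : ℕ) (κ : ℝ), t / Real.log n ≤ C → t / Real.log n / p < κ →
      κ / 2 * LambdaStar p (t / Real.log n / κ) = 1 →
      bernProb (fun _ => p) {f : Sym2 (Fin n) → Bool | (1 + 4 * ε) * (n / (κ * Real.log n)) <
        (improperChromaticNumber (SimpleGraph.fromEdgeSet {e | f e = true}) t : ℝ)} ≤ 1 / n := by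
  have ha : 0 < -Real.log (1 - p) := neg_pos.2 (Real.log_neg (by linarith) (by linarith))
  set a := -Real.log (1 - p) with ha'
  set K := max (2 * C / p) (2 / LambdaStar p (p / 2)) with hK
  have hK0 : 0 < K := lt_max_of_lt_right (div_pos two_pos
    (LambdaStar_pos hp0 hp1 (by linarith) (by linarith)))
  obtain ⟨k₀, hk₀⟩ := exists_bernProb_biInter_compl_degreeLeEvent_le hp0 hp1 hε0
    (by linarith : ε ≤ 1 / 2) hK0
  have hLtop : Tendsto (fun n : ℕ => Real.log n) atTop atTop :=
    Real.tendsto_log_atTop.comp tendsto_natCast_atTop_atTop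
  filter_upwards [hLtop.eventually_ge_atTop 1, hLtop.eventually_ge_atTop (2 * K / ε),
    hLtop.eventually_ge_atTop (a * k₀), hLtop.eventually_ge_atTop (a * 2 / ε),
    hLtop.eventually_ge_atTop (a * 2),
    hLtop.eventually (eventually_mul_pow_le_exp one_pos 1 2),
    hLtop.eventually (eventually_mul_pow_le_exp (by linarith : 0 < ε / 4) (K ^ 2) 4),
    hLtop.eventually (eventually_mul_pow_le_exp (by norm_num : (0 : ℝ) < 1 / 2) (8 * K) 1),
    eventually_ge_atTop 2]
    with n hL hLK hLk₀ hLε hLa hE1 hE2 hE3 hn t κ htC hκ hκΛ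
  have hn0 : (0 : ℝ) < n := by exact_mod_cast (by omega : 0 < n)
  have hexp : Real.exp (Real.log n) = n := Real.exp_log hn0
  have hLn : Real.log n ≤ n := by linarith [Real.log_le_sub_one_of_pos hn0]
  set L := Real.log n
  rw [one_mul, one_mul, hexp] at hE1
  have hL0 : 0 < L := by linarith
  have hτ : 0 ≤ t / L := by positivity
  have hκ0 : 0 < κ := kappa_pos hp0 hτ hκ
  have hκK : κ ≤ K := kappa_le hp0 hp1 hτ htC hκ hκΛ
  have hκa : 2 / a ≤ κ := le_kappa hp0 hp1 hτ hκ hκΛ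
  set A := κ * L with hA
  have hA0 : 0 < A := by positivity
  have hAK : A ≤ K * L := mul_le_mul_of_nonneg_right hκK hL0.le
  have hAa : 2 * L ≤ A * a := by
    rw [div_le_iff₀ ha] at hκa
    nlinarith only [hκa, hL0, hA]
  have hAε : 4 ≤ ε * A := by
    rw [div_le_iff₀ hε0] at hLε
    refine le_of_mul_le_mul_right ?_ ha
    nlinarith only [mul_le_mul_of_nonneg_left hAa hε0.le, hLε]
  set k := ⌊(1 - ε) * A⌋₊ with hk
  have hkA : (k : ℝ) ≤ (1 - ε) * A := Nat.floor_le (mul_nonneg (by linarith) hA0.le)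
  have hAk : (1 - 5 / 4 * ε) * A ≤ k := by
    have := Nat.lt_floor_add_one ((1 - ε) * A)
    linarith
  have hkA2 : A ≤ 2 * k := by nlinarith only [hAk, mul_le_mul_of_nonneg_right hε1 hA0.le, hA0]
  have hkk₀ : k₀ ≤ k := by
    have : (k₀ : ℝ) ≤ k := by
      refine le_of_mul_le_mul_left ?_ ha
      nlinarith only [hLk₀, hAa, mul_le_mul_of_nonneg_left hkA2 ha.le]
    exact_mod_cast this
  have hk2 : (2 : ℝ) ≤ k := by
    refine le_of_mul_le_mul_left ?_ ha
    nlinarith only [hLa, hAa, mul_le_mul_of_nonneg_left hkA2 ha.le]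
  have hk0 : 0 < k := by
    have : (0 : ℝ) < k := by linarith
    exact_mod_cast this
  have hkK : (k : ℝ) ≤ K * L := by nlinarith only [hkA, hAK, mul_pos hε0 hA0]
  set m := ⌈(n : ℝ) / L ^ 2⌉₊ with hm
  have hmn : n / L ^ 2 ≤ m := Nat.le_ceil _
  have hm1 : m ≤ 2 * (n / L ^ 2) := by
    have h1 := Nat.ceil_lt_add_one (by positivity : 0 ≤ (n : ℝ) / L ^ 2)
    have h2 : 1 ≤ n / L ^ 2 := by rwa [one_le_div (by positivity)]
    linarith
  have hΛ : ((k : ℝ) - 1) / 2 * LambdaStar p (min (t / ((k : ℝ) - 1)) p) ≤ (1 - ε) * L := by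
    have h0 : 0 < (k : ℝ) - 1 := by linarith
    have h1 := half_mul_LambdaStar_min_le hp0 hp1 hτ hκ hκΛ (c := 1 - ε) (κ' := ((k : ℝ) - 1) / L)
      (by linarith) (by positivity) (by rw [div_le_iff₀ hL0]; linarith)
    have h2 : t / L / (((k : ℝ) - 1) / L) = t / ((k : ℝ) - 1) := by field_simp
    rw [h2] at h1
    calc _ = ((k : ℝ) - 1) / L / 2 * LambdaStar p (min (t / ((k : ℝ) - 1)) p) * L := by field_simp
      _ ≤ _ := by gcongr
  have hp : 0 ≤ p ∧ p ≤ 1 := ⟨hp0.le, hp1.le⟩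
  have hWm : ∀ W : Finset (Fin n), m ≤ W.card →
      (k : ℝ) ^ 2 ≤ W.card * Real.exp (-((1 - ε / 4) * L)) := by
    intro W hW
    calc (k : ℝ) ^ 2 ≤ (K * L) ^ 2 := by gcongr
      _ = K ^ 2 * L ^ 4 / L ^ 2 := by field_simp
      _ ≤ Real.exp (ε / 4 * L) / L ^ 2 := by gcongr
      _ = n / L ^ 2 * Real.exp (-((1 - ε / 4) * L)) := by
        have h : Real.exp (ε / 4 * L) = n * Real.exp (-((1 - ε / 4) * L)) := by
          rw [← hexp, ← Real.exp_add]
          ring_nf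
        rw [h]
        ring
      _ ≤ m * Real.exp (-((1 - ε / 4) * L)) := by gcongr
      _ ≤ _ := by gcongr
  have hsub : {f : Sym2 (Fin n) → Bool | (1 + 4 * ε) * (n / A) <
        (improperChromaticNumber (SimpleGraph.fromEdgeSet {e | f e = true}) t : ℝ)} ⊆
      ⋃ W ∈ (Finset.univ : Finset (Fin n)).powerset.filter fun W => m ≤ W.card,
        ⋂ T ∈ W.powersetCard k, (degreeLeEvent t T T)ᶜ := by
    intro f hf
    by_contra hcon
    have h1 := improperChromaticNumber_mul_le
      (G := SimpleGraph.fromEdgeSet {e | f e = true}) (t := t) (k := k) (m := m) (fun W hW => by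
        by_contra h
        refine hcon (Set.mem_iUnion₂.2 ⟨W, Finset.mem_filter.2
          ⟨Finset.mem_powerset.2 (Finset.subset_univ _), hW⟩, Set.mem_iInter₂.2 fun T hT hf' => ?_⟩)
        rw [Finset.mem_powersetCard] at hT
        exact h ⟨T, hT.1, hT.2, (isTDependent_fromEdgeSet_iff f t T).2 hf'⟩) hk0
    rw [Fintype.card_fin] at h1
    have h2 : (improperChromaticNumber (SimpleGraph.fromEdgeSet {e | f e = true}) t : ℝ) * k ≤
        n + m * k := by exact_mod_cast h1
    have hf' : (1 + 4 * ε) * (n / A) <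
      (improperChromaticNumber (SimpleGraph.fromEdgeSet {e | f e = true}) t : ℝ) := hf
    set χ : ℝ := (improperChromaticNumber (SimpleGraph.fromEdgeSet {e | f e = true}) t : ℝ)
    have h3 : n ≤ (1 + 3 * ε) * (n / A) * k := by
      have h5 : 0 ≤ (1 + 3 * ε) * (n / A) := by positivity
      calc (n : ℝ) = n / A * A := by field_simp
        _ ≤ n / A * ((1 + 3 * ε) * ((1 - 5 / 4 * ε) * A)) := by
          gcongr
          nlinarith only [mul_pos hε0 hA0, mul_le_mul_of_nonneg_left hε1 (mul_pos hε0 hA0).le]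
        _ = (1 + 3 * ε) * (n / A) * ((1 - 5 / 4 * ε) * A) := by ring
        _ ≤ _ := by gcongr
    have h4 : (m : ℝ) ≤ ε * (n / A) := by
      refine hm1.trans ?_
      rw [div_le_iff₀ hε0] at hLK
      rw [← mul_div_assoc, ← mul_div_assoc, div_le_div_iff₀ (by positivity) hA0]
      have h5 : 2 * A ≤ ε * L ^ 2 := by
        nlinarith only [hAK, mul_le_mul_of_nonneg_right hLK hL0.le]
      nlinarith only [mul_le_mul_of_nonneg_left h5 hn0.le]
    have h5 : (m : ℝ) * k ≤ ε * (n / A) * k := by gcongr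
    have hk0' : (0 : ℝ) < k := by linarith
    have h6 := mul_lt_mul_of_pos_right hf' hk0'
    linarith
  refine (bernProb_mono (fun _ => hp) hsub).trans ((bernProb_biUnion_le (fun _ => hp) _ _).trans ?_)
  refine (Finset.sum_le_card_nsmul _ _ (Real.exp (-(2 * n))) fun W hW => ?_).trans ?_
  · refine (hk₀ n t k W L hkk₀ hL0 hkK hΛ (hWm W (Finset.mem_filter.1 hW).2)).trans ?_
    rw [Real.exp_le_exp, neg_le_neg_iff, le_div_iff₀ (by linarith)]
    calc 2 * n * (4 * (k : ℝ)) ≤ 2 * n * (4 * (K * L)) := by gcongr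
      _ = n * (8 * K * L ^ 1) := by ring
      _ ≤ n * Real.exp (1 / 2 * L) := by gcongr
      _ = _ := by
        rw [← hexp, ← Real.exp_add]
        ring_nf
  · rw [nsmul_eq_mul]
    have h1 : (((Finset.univ : Finset (Fin n)).powerset.filter fun W => m ≤ W.card).card : ℝ) ≤
        Real.exp n := by
      calc _ ≤ (((Finset.univ : Finset (Fin n)).powerset).card : ℝ) := by
            exact_mod_cast Finset.card_filter_le _ _
        _ = (2 : ℝ) ^ n := by simp
        _ ≤ Real.exp 1 ^ n := by
          gcongr
          linarith [Real.add_one_le_exp (1 : ℝ)]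
        _ = _ := by rw [← Real.exp_nat_mul, mul_one]
    calc _ ≤ Real.exp n * Real.exp (-(2 * n)) := by gcongr
      _ ≤ Real.exp (-L) := by
        rw [← Real.exp_add, Real.exp_le_exp]
        linarith
      _ = 1 / n := by rw [Real.exp_neg, hexp, one_div]

end Asymptotics

lemma erMeasure_univ {n : ℕ} {p : ℝ} (hp : 0 ≤ p ∧ p ≤ 1) : erMeasure n p Set.univ = 1 := by
  rw [erMeasure_apply hp]
  simp [bernProb_univ]

/-- Fix `0 < p < 1` and let `κ_p` be the function assigning to each `τ ≥ 0`
the unique `κ > τ/p` with `(κ/2)·Λ*(τ/κ) = 1`.  If `t(n) = o(n)` then asymptotically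
almost surely `χ^{t(n)}(G(n,p)) = (1+o(1))·n/(κ_p(t(n)/ln n)·ln n)`. -/
theorem stmt1 (p : ℝ) (hp0 : 0 < p) (hp1 : p < 1)
    (κf : ℝ → ℝ)
    (hκf : ∀ τ : ℝ, 0 ≤ τ → τ / p < κf τ ∧ κf τ / 2 * LambdaStar p (τ / κf τ) = 1)
    (hκuniq : ∀ τ : ℝ, 0 ≤ τ → ∀ κ : ℝ, τ / p < κ → κ / 2 * LambdaStar p (τ / κ) = 1 → κ = κf τ)
    (t : ℕ → ℕ) (ht : Tendsto (fun n => (t n : ℝ) / (n : ℝ)) atTop (nhds 0))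
    (ε : ℝ) (hε : 0 < ε) :
    Tendsto (fun n => erMeasure n p
        {G | (1 - ε) * ((n : ℝ) / (κf ((t n : ℝ) / Real.log n) * Real.log n))
              ≤ (improperChromaticNumber G (t n) : ℝ) ∧
            (improperChromaticNumber G (t n) : ℝ)
              ≤ (1 + ε) * ((n : ℝ) / (κf ((t n : ℝ) / Real.log n) * Real.log n))})
      atTop (nhds 1) := by
  have hp : 0 ≤ p ∧ p ≤ 1 := ⟨hp0.le, hp1.le⟩
  set δ := min (1 / 4) (ε / 4) with hδ
  have hδ0 : 0 < δ := lt_min (by norm_num) (by positivity)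
  have hδ4 : δ ≤ 1 / 4 := min_le_left _ _
  have hδε : 4 * δ ≤ ε := by linarith [min_le_right (1 / 4) (ε / 4)]
  obtain ⟨C, _, c, hc, hlarge⟩ :=
    exists_bernProb_lt_improperChromaticNumber_le_of_large hp0 hp1 hδ0 (by linarith)
  have hbdd := bernProb_lt_improperChromaticNumber_le_of_bounded (C := C) hp0 hp1 hδ0 hδ4
  have hlow := bernProb_improperChromaticNumber_lt_le hp0 hp1 (half_pos hε)
  have hbound : ∀ᶠ n : ℕ in atTop, ENNReal.ofReal (1 - (1 / n + 1 / n)) ≤ erMeasure n p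
        {G | (1 - ε) * ((n : ℝ) / (κf ((t n : ℝ) / Real.log n) * Real.log n))
              ≤ (improperChromaticNumber G (t n) : ℝ) ∧
            (improperChromaticNumber G (t n) : ℝ)
              ≤ (1 + ε) * ((n : ℝ) / (κf ((t n : ℝ) / Real.log n) * Real.log n))} := by
    filter_upwards [hlarge, hbdd, hlow, ht.eventually (ge_mem_nhds hc)] with n h1 h2 h3 h4
    have hL : 0 ≤ Real.log n := Real.log_natCast_nonneg n
    obtain ⟨hκ, hκΛ⟩ := hκf (t n / Real.log n) (by positivity)
    have hκ0 := kappa_pos hp0 (by positivity) hκ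
    set κ := κf (t n / Real.log n)
    have hup : bernProb (fun _ => p) {f : Sym2 (Fin n) → Bool | (1 + 4 * δ) *
        (n / (κ * Real.log n)) < (improperChromaticNumber
          (SimpleGraph.fromEdgeSet {e | f e = true}) (t n) : ℝ)} ≤ 1 / n := by
      rcases le_or_gt C (t n / Real.log n) with hC | hC
      · exact h1 _ _ h4 hC hκ hκΛ
      · exact h2 _ _ hC.le hκ hκΛ
    have hx : 0 ≤ n / (κ * Real.log n) := by positivity
    rw [erMeasure_apply hp]
    refine ENNReal.ofReal_le_ofReal ?_
    rw [← sub_le_comm, ← bernProb_compl]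
    refine (bernProb_mono (fun _ => hp) fun f hf => ?_).trans
      ((bernProb_union_le (fun _ => hp) _ _).trans (add_le_add (h3 _ _ hκ hκΛ) hup))
    simp only [Set.mem_compl_iff, Set.mem_ofPred_eq, not_and_or, not_le] at hf
    rw [Set.mem_union, Set.mem_ofPred_eq, Set.mem_ofPred_eq]
    rcases hf with hf | hf
    · left
      rwa [mul_div_cancel₀ _ two_ne_zero]
    · right
      refine lt_of_le_of_lt ?_ hf
      gcongr
  have hlim : Tendsto (fun n : ℕ => ENNReal.ofReal (1 - (1 / n + 1 / n))) atTop (nhds 1) := by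
    rw [← ENNReal.ofReal_one]
    refine ENNReal.tendsto_ofReal ?_
    have h := tendsto_one_div_atTop_nhds_zero_nat (𝕜 := ℝ)
    simpa using tendsto_const_nhds (x := (1 : ℝ)).sub (h.add h)
  exact tendsto_of_tendsto_of_tendsto_of_le_of_le' hlim tendsto_const_nhds hbound
    (Eventually.of_forall fun n => (measure_mono (Set.subset_univ _)).trans_eq (erMeasure_univ hp))
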